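/- arXiv:0805.1614 — 8 statements merged into one kernel-verified Lean document; each statement's English description precedes it below -/
import Mathlib

section
/- Let U_n ⊂ U_{n+1} ⊂ C^{n+1}([a,b]) be linear subspaces of dimensions n+1 and n+2 respectively, possessing Bernstein bases p_{n,0},...,p_{n,n} and p_{n+1,0},...,p_{n+1,n+1}. Then for each k = 0,...,n one has the degree-elevation identity p_{n,k} = (p_{n,k}^{(k)}(a) / p_{n+1,k}^{(k)}(a)) · p_{n+1,k} + (p_{n,k}^{(n-k)}(b) / p_{n+1,k+1}^{(n-k)}(b)) · p_{n+1,k+1} on [a,b]. -/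
open Finset

/-- If the functionals `A i` are triangular with respect to the family `q`, then a combination of
the `q j` annihilated by all `A j` with `j ≤ i` has vanishing `i`-th coefficient. -/
theorem coeff_eq_zero_of_triangular {ι K V : Type*} [Fintype ι] [LinearOrder ι] [Field K]
    [AddCommGroup V] [Module K V] (q : ι → V) (A : ι → V →ₗ[K] K)
    (hA : ∀ i j, i < j → A i (q j) = 0) (hA' : ∀ i, A i (q i) ≠ 0) (c : ι → K) (i : ι)
    (h : ∀ j ≤ i, A j (∑ l, c l • q l) = 0) : c i = 0 := by
  induction i using WellFoundedLT.induction with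
  | ind i ih =>
    have hi := h i le_rfl
    rw [map_sum, Finset.sum_eq_single i] at hi
    · simpa [hA' i] using hi
    · intro l _ hl
      rcases lt_or_gt_of_ne hl with hl | hl
      · simp [ih l hl fun j hj => h j (hj.trans hl.le)]
      · simp [hA i l hl]
    · simp

/-- In a space spanned by a family `q` that is triangular for two families of functionals `A` and
`B` in opposite orders, a vector is zero if every index is covered by the vanishing of either all
smaller `A j` or all larger `B j`. -/
theorem eq_zero_of_triangular {ι K V : Type*} [Fintype ι] [LinearOrder ι] [Field K]
    [AddCommGroup V] [Module K V] [Nonempty ι]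
    (hcard : Fintype.card ι = Module.finrank K V)
    (q : ι → V) (A B : ι → V →ₗ[K] K)
    (hA : ∀ i j, i < j → A i (q j) = 0) (hA' : ∀ i, A i (q i) ≠ 0)
    (hB : ∀ i j, j < i → B i (q j) = 0) (hB' : ∀ i, B i (q i) ≠ 0) (f : V)
    (h : ∀ i, (∀ j ≤ i, A j f = 0) ∨ ∀ j ≥ i, B j f = 0) : f = 0 := by
  have hli : LinearIndependent K q := by
    rw [Fintype.linearIndependent_iff]
    intro c hc i
    exact coeff_eq_zero_of_triangular q A hA hA' c i fun j _ => by simp [hc]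
  obtain ⟨c, rfl⟩ : ∃ c : ι → K, ∑ i, c i • q i = f := by
    rw [← Submodule.mem_span_range_iff_exists_fun,
      hli.span_eq_top_of_card_eq_finrank hcard]
    trivial
  refine Finset.sum_eq_zero fun i _ => ?_
  have hi : c i = 0 := by
    rcases h i with h | h
    · exact coeff_eq_zero_of_triangular q A hA hA' c i h
    · exact coeff_eq_zero_of_triangular (ι := ιᵒᵈ) q B hB hB' c i h
  rw [hi, zero_smul]

/-- The `i`-th derivative at `x`, as a linear functional on a space of `C^m` functions, `i ≤ m`. -/
noncomputable def iteratedDerivAt {m i : ℕ} (U : Submodule ℝ (ℝ → ℝ))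
    (hU : ∀ f ∈ U, ContDiff ℝ m f) (hi : i ≤ m) (x : ℝ) : U →ₗ[ℝ] ℝ where
  toFun f := iteratedDeriv i (f : ℝ → ℝ) x
  map_add' f g := iteratedDeriv_add
    ((hU f f.2).of_le (by exact_mod_cast hi)).contDiffAt
    ((hU g g.2).of_le (by exact_mod_cast hi)).contDiffAt
  map_smul' r f := iteratedDeriv_const_smul
    ((hU f f.2).of_le (by exact_mod_cast hi : (i : WithTop ℕ∞) ≤ m)).contDiffAt r

/-- degree elevation identity for Bernstein bases of nested subspaces. -/
theorem degree_elevation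
    (n : ℕ) (a b : ℝ) (hab : a < b)
    (Un Un1 : Submodule ℝ (ℝ → ℝ)) (hsub : Un ≤ Un1)
    (hdimn : Module.finrank ℝ Un = n + 1)
    (hdimn1 : Module.finrank ℝ Un1 = n + 2)
    (hsmooth : ∀ f ∈ Un1, ContDiff ℝ (n + 1) f)
    (p q : ℕ → ℝ → ℝ)
    (hpU : ∀ k ≤ n, p k ∈ Un)
    (hqU : ∀ k ≤ n + 1, q k ∈ Un1)
    (hpB : ∀ k ≤ n,
      (∀ i < k, iteratedDeriv i (p k) a = 0) ∧ iteratedDeriv k (p k) a ≠ 0 ∧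
      (∀ i < n - k, iteratedDeriv i (p k) b = 0) ∧ iteratedDeriv (n - k) (p k) b ≠ 0)
    (hqB : ∀ k ≤ n + 1,
      (∀ i < k, iteratedDeriv i (q k) a = 0) ∧ iteratedDeriv k (q k) a ≠ 0 ∧
      (∀ i < n + 1 - k, iteratedDeriv i (q k) b = 0) ∧ iteratedDeriv (n + 1 - k) (q k) b ≠ 0)
    (k : ℕ) (hk : k ≤ n) :
    ∀ x ∈ Set.Icc a b,
      p k x = (iteratedDeriv k (p k) a / iteratedDeriv k (q k) a) * q k x
        + (iteratedDeriv (n - k) (p k) b / iteratedDeriv (n - k) (q (k + 1)) b) * q (k + 1) x := by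
  have hU : ∀ f ∈ Un1, ContDiff ℝ (n + 1 : ℕ) f := fun f hf => mod_cast hsmooth f hf
  let Q : Fin (n + 2) → Un1 := fun j => ⟨q j, hqU j (by omega)⟩
  let P : Un1 := ⟨p k, hsub (hpU k hk)⟩
  let A : Fin (n + 2) → Un1 →ₗ[ℝ] ℝ := fun j =>
    iteratedDerivAt Un1 hU (show (j : ℕ) ≤ n + 1 by omega) a
  let B : Fin (n + 2) → Un1 →ₗ[ℝ] ℝ := fun j =>
    iteratedDerivAt Un1 hU (show n + 1 - (j : ℕ) ≤ n + 1 by omega) b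
  let k₀ : Fin (n + 2) := ⟨k, by omega⟩
  let k₁ : Fin (n + 2) := ⟨k + 1, by omega⟩
  let α := iteratedDeriv k (p k) a / iteratedDeriv k (q k) a
  let β := iteratedDeriv (n - k) (p k) b / iteratedDeriv (n - k) (q (k + 1)) b
  have hA : ∀ i j, i < j → A i (Q j) = 0 := fun i j hij => (hqB j (by omega)).1 i hij
  have hA' : ∀ i, A i (Q i) ≠ 0 := fun i => (hqB i (by omega)).2.1
  have hB : ∀ i j, j < i → B i (Q j) = 0 := fun i j hij =>
    (hqB j (by omega)).2.2.1 (n + 1 - i) (by omega)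
  have hB' : ∀ i, B i (Q i) ≠ 0 := fun i => (hqB i (by omega)).2.2.2
  have hk₁ : n + 1 - (k + 1) = n - k := by omega
  have key : P - α • Q k₀ - β • Q k₁ = 0 := by
    refine eq_zero_of_triangular (by simp [hdimn1]) Q A B hA hA' hB hB' _ fun i => ?_
    rcases le_or_gt i k₀ with hi | hi
    · refine Or.inl fun j hj => ?_
      have hjk : j ≤ k₀ := hj.trans hi
      have hjk₁ : A j (Q k₁) = 0 := hA j k₁ (lt_of_le_of_lt hjk (Nat.lt_succ_self k))
      rw [map_sub, map_sub, map_smul, map_smul, hjk₁, smul_zero, sub_zero, smul_eq_mul]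
      rcases hjk.lt_or_eq with hjk | rfl
      · have hP : A j P = 0 := (hpB k hk).1 j hjk
        rw [hP, hA j k₀ hjk, mul_zero, sub_zero]
      · exact sub_eq_zero.2 (div_mul_cancel₀ _ (hA' k₀)).symm
    · refine Or.inr fun j hj => ?_
      have hjk : k₁ ≤ j := Nat.succ_le_of_lt (lt_of_lt_of_le hi hj)
      have hjk₀ : B j (Q k₀) = 0 := hB j k₀ (lt_of_lt_of_le (Nat.lt_succ_self k) hjk)
      rw [map_sub, map_sub, map_smul, map_smul, hjk₀, smul_zero, sub_zero, smul_eq_mul]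
      rcases hjk.lt_or_eq with hjk | rfl
      · have hP : B j P = 0 := by
          have hjk' : k + 1 < (j : ℕ) := hjk
          exact (hpB k hk).2.2.1 (n + 1 - j) (by omega)
        rw [hP, hB j k₁ hjk, mul_zero, sub_zero]
      · have hP : B k₁ P = iteratedDeriv (n - k) (p k) b :=
          congrArg (iteratedDeriv · (p k) b) hk₁
        have hQ : B k₁ (Q k₁) = iteratedDeriv (n - k) (q (k + 1)) b :=
          congrArg (iteratedDeriv · (q (k + 1)) b) hk₁
        have hne := hB' k₁
        rw [hQ] at hne
        rw [hP, hQ]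
        exact sub_eq_zero.2 (div_mul_cancel₀ _ hne).symm
  intro x _
  have hx : p k x - α * q k x - β * q (k + 1) x = 0 :=
    congrFun (congrArg Subtype.val key) x
  linarith
end

section
/- Let n ≥ 1, let U_n ⊂ C^n([a,b]) be an (n+1)-dimensional linear subspace with a non-negative Bernstein basis p_{n,0},...,p_{n,n}, and let (f_0, f_1) be a Haar pair with f_0, f_1 ∈ U_n. Write f_0 = Σ_{k=0}^n β_{n,k} p_{n,k} and f_1 = Σ_{k=0}^n γ_{n,k} p_{n,k}. If there exists a Bernstein operator B_n : C[a,b] → U_n fixing f_0 and f_1, with nodes t_{n,0},...,t_{n,n} ∈ [a,b] and positive coefficients α_{n,0},...,α_{n,n}, then: (i) β_{n,k} > 0 for all k; (ii) t_{n,0} = a and t_{n,n} = b; (iii) for each k, (f_1/f_0)(t_{n,k}) = γ_{n,k}/β_{n,k} (so the nodes are uniquely determined since f_1/f_0 is injective); (iv) α_{n,k} = β_{n,k}/f_0(t_{n,k}) for each k; in particular α_{n,0} = 1/p_{n,0}(a) and α_{n,n} = 1/p_{n,n}(b). -/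
open Finset

def IsBernsteinBasisOf (n : ℕ) (a b : ℝ) (U : Submodule ℝ (ℝ → ℝ)) (p : ℕ → ℝ → ℝ) : Prop :=
  (∀ k ≤ n, p k ∈ U) ∧
  (∀ k ≤ n, ContDiff ℝ n (p k)) ∧
  (∀ k ≤ n,
    (∀ i < k, iteratedDeriv i (p k) a = 0) ∧ iteratedDeriv k (p k) a ≠ 0 ∧
    (∀ i < n - k, iteratedDeriv i (p k) b = 0) ∧ iteratedDeriv (n - k) (p k) b ≠ 0)

def IsNonnegBernsteinBasisOf (n : ℕ) (a b : ℝ) (U : Submodule ℝ (ℝ → ℝ)) (p : ℕ → ℝ → ℝ) : Prop :=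
  IsBernsteinBasisOf n a b U p ∧ ∀ k ≤ n, ∀ x ∈ Set.Icc a b, 0 ≤ p k x

def IsHaarPair (a b : ℝ) (f0 f1 : ℝ → ℝ) : Prop :=
  ContinuousOn f0 (Set.Icc a b) ∧ ContinuousOn f1 (Set.Icc a b) ∧
  (∀ x ∈ Set.Icc a b, 0 < f0 x) ∧
  StrictMonoOn (fun x => f1 x / f0 x) (Set.Icc a b)

noncomputable def bernOp (n : ℕ) (p : ℕ → ℝ → ℝ) (t : ℕ → ℝ) (α : ℕ → ℝ) (f : ℝ → ℝ) : ℝ → ℝ :=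
  fun x => ∑ k ∈ Finset.range (n + 1), f (t k) * α k * p k x

def FixesOn (a b : ℝ) (B : (ℝ → ℝ) → ℝ → ℝ) (f : ℝ → ℝ) : Prop :=
  ∀ x ∈ Set.Icc a b, B f x = f x

def ConvexWrt (a b : ℝ) (f0 f1 f : ℝ → ℝ) : Prop :=
  ∀ x0 ∈ Set.Icc a b, ∀ x1 ∈ Set.Icc a b, ∀ x2 ∈ Set.Icc a b, x0 < x1 → x1 < x2 →
    0 ≤ Matrix.det !![f0 x0, f0 x1, f0 x2; f1 x0, f1 x1, f1 x2; f x0, f x1, f x2]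

def IsExtChebyshev (m : ℕ) (a b : ℝ) (U : Submodule ℝ (ℝ → ℝ)) : Prop :=
  Module.finrank ℝ U = m + 1 ∧
  (∀ f ∈ U, ContDiff ℝ m f) ∧
  (∀ f ∈ U, f ≠ 0 → ∀ (S : Finset ℝ) (μ : ℝ → ℕ),
    (∀ x ∈ S, x ∈ Set.Icc a b) →
    (∀ x ∈ S, ∀ i < μ x, iteratedDeriv i f x = 0) →
    ∑ x ∈ S, μ x ≤ m)

/-- The members of a Bernstein basis are linearly independent as functions on `[a, b]`. -/
theorem IsBernsteinBasisOf.coeff_eq_zero {n : ℕ} {a b : ℝ} (hab : a < b)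
    {U : Submodule ℝ (ℝ → ℝ)} {p : ℕ → ℝ → ℝ} (hp : IsBernsteinBasisOf n a b U p)
    {c : ℕ → ℝ} (hc : ∀ x ∈ Set.Icc a b, ∑ k ∈ Finset.range (n + 1), c k * p k x = 0) :
    ∀ k ≤ n, c k = 0 := by
  obtain ⟨-, hsmooth, hzero⟩ := hp
  have ha : a ∈ Set.Icc a b := Set.left_mem_Icc.2 hab.le
  have hderiv : ∀ i ≤ n, ∑ k ∈ Finset.range (n + 1), c k * iteratedDeriv i (p k) a = 0 := by
    intro i hi
    have hpi : ∀ k ∈ Finset.range (n + 1), ContDiffAt ℝ i (p k) a := fun k hk =>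
      ((hsmooth k (Finset.mem_range_succ_iff.1 hk)).of_le (by exact_mod_cast hi)).contDiffAt
    have hterm : ∀ k ∈ Finset.range (n + 1), ContDiffAt ℝ i (fun x => c k * p k x) a :=
      fun k hk => contDiffAt_const.mul (hpi k hk)
    calc ∑ k ∈ Finset.range (n + 1), c k * iteratedDeriv i (p k) a
        = iteratedDeriv i (fun x => ∑ k ∈ Finset.range (n + 1), c k * p k x) a := by
          rw [iteratedDeriv_fun_sum hterm]
          exact Finset.sum_congr rfl fun k hk => (iteratedDeriv_const_mul (c k) (hpi k hk)).symm
      _ = iteratedDerivWithin i (fun x => ∑ k ∈ Finset.range (n + 1), c k * p k x)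
            (Set.Icc a b) a :=
          (iteratedDerivWithin_eq_iteratedDeriv (uniqueDiffOn_Icc hab)
            (ContDiffAt.sum hterm) ha).symm
      _ = iteratedDerivWithin i (fun _ => (0 : ℝ)) (Set.Icc a b) a :=
          iteratedDerivWithin_congr hc ha
      _ = 0 := by simp
  intro k
  induction k using Nat.strong_induction_on with
  | _ k ih =>
    intro hk
    have hsum := hderiv k hk
    rw [Finset.sum_eq_single_of_mem k (Finset.mem_range_succ_iff.2 hk)] at hsum
    · exact (mul_eq_zero.1 hsum).resolve_right (hzero k hk).2.1
    · intro j hj hjk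
      have hjn := Finset.mem_range_succ_iff.1 hj
      rcases lt_or_gt_of_ne hjk with h | h
      · rw [ih j h hjn, zero_mul]
      · rw [(hzero j hjn).1 k h, mul_zero]

/-- An operator fixing a function determines the coefficients of that function. -/
theorem IsBernsteinBasisOf.coeff_eq_of_fixesOn {n : ℕ} {a b : ℝ} (hab : a < b)
    {U : Submodule ℝ (ℝ → ℝ)} {p : ℕ → ℝ → ℝ} (hp : IsBernsteinBasisOf n a b U p)
    {f : ℝ → ℝ} {β t α : ℕ → ℝ}
    (hβ : ∀ x ∈ Set.Icc a b, f x = ∑ k ∈ Finset.range (n + 1), β k * p k x)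
    (hfix : FixesOn a b (bernOp n p t α) f) :
    ∀ k ≤ n, β k = f (t k) * α k := by
  intro k hk
  refine sub_eq_zero.1 (hp.coeff_eq_zero hab (c := fun k => β k - f (t k) * α k) ?_ k hk)
  intro x hx
  simp only [sub_mul, Finset.sum_sub_distrib]
  rw [← hβ x hx, sub_eq_zero]
  exact (hfix x hx).symm

theorem IsBernsteinBasisOf.sum_left {n : ℕ} {a b : ℝ}
    {U : Submodule ℝ (ℝ → ℝ)} {p : ℕ → ℝ → ℝ} (hp : IsBernsteinBasisOf n a b U p) (c : ℕ → ℝ) :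
    ∑ k ∈ Finset.range (n + 1), c k * p k a = c 0 * p 0 a := by
  refine Finset.sum_eq_single_of_mem 0 (by simp) fun k hk hk0 => ?_
  have h := (hp.2.2 k (Finset.mem_range_succ_iff.1 hk)).1 0 (Nat.pos_of_ne_zero hk0)
  rw [iteratedDeriv_zero] at h
  rw [h, mul_zero]

theorem IsBernsteinBasisOf.sum_right {n : ℕ} {a b : ℝ}
    {U : Submodule ℝ (ℝ → ℝ)} {p : ℕ → ℝ → ℝ} (hp : IsBernsteinBasisOf n a b U p) (c : ℕ → ℝ) :
    ∑ k ∈ Finset.range (n + 1), c k * p k b = c n * p n b := by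
  refine Finset.sum_eq_single_of_mem n (by simp) fun k hk hkn => ?_
  have hk' := Finset.mem_range_succ_iff.1 hk
  have h := (hp.2.2 k hk').2.2.1 0 (by omega)
  rw [iteratedDeriv_zero] at h
  rw [h, mul_zero]

/-- uniqueness of nodes and coefficients of a Bernstein operator
fixing a Haar pair. -/
theorem bernstein_operator_nodes_coefficients
    (n : ℕ) (hn : 1 ≤ n) (a b : ℝ) (hab : a < b)
    (U : Submodule ℝ (ℝ → ℝ)) (hdim : Module.finrank ℝ U = n + 1)
    (p : ℕ → ℝ → ℝ) (hp : IsNonnegBernsteinBasisOf n a b U p)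
    (f0 f1 : ℝ → ℝ) (hf0U : f0 ∈ U) (hf1U : f1 ∈ U)
    (hHaar : IsHaarPair a b f0 f1)
    (β γ : ℕ → ℝ)
    (hβ : ∀ x ∈ Set.Icc a b, f0 x = ∑ k ∈ Finset.range (n + 1), β k * p k x)
    (hγ : ∀ x ∈ Set.Icc a b, f1 x = ∑ k ∈ Finset.range (n + 1), γ k * p k x)
    (t : ℕ → ℝ) (α : ℕ → ℝ)
    (ht : ∀ k ≤ n, t k ∈ Set.Icc a b)
    (hα : ∀ k ≤ n, 0 < α k)
    (hfix0 : FixesOn a b (bernOp n p t α) f0)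
    (hfix1 : FixesOn a b (bernOp n p t α) f1) :
    (∀ k ≤ n, 0 < β k) ∧
    t 0 = a ∧ t n = b ∧
    (∀ k ≤ n, f1 (t k) / f0 (t k) = γ k / β k) ∧
    (∀ k ≤ n, α k = β k / f0 (t k)) ∧
    α 0 = 1 / p 0 a ∧ α n = 1 / p n b := by
  obtain ⟨-, -, hpos, hmono⟩ := hHaar
  have hB := hp.1
  have hβα := hB.coeff_eq_of_fixesOn hab hβ hfix0
  have hγα := hB.coeff_eq_of_fixesOn hab hγ hfix1
  have hf0 : ∀ k ≤ n, 0 < f0 (t k) := fun k hk => hpos _ (ht k hk)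
  have hβpos : ∀ k ≤ n, 0 < β k := fun k hk => hβα k hk ▸ mul_pos (hf0 k hk) (hα k hk)
  have hratio : ∀ k ≤ n, f1 (t k) / f0 (t k) = γ k / β k := fun k hk => by
    rw [hγα k hk, hβα k hk, mul_div_mul_right _ _ (hα k hk).ne']
  have hcoeff : ∀ k ≤ n, α k = β k / f0 (t k) := fun k hk => by
    rw [hβα k hk, mul_div_cancel_left₀ _ (hf0 k hk).ne']
  have hnode : ∀ k ≤ n, ∀ x ∈ Set.Icc a b, f0 x = β k * p k x → f1 x = γ k * p k x →
      t k = x ∧ α k = 1 / p k x := by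
    intro k hk x hx h0 h1
    have hβk := (hβpos k hk).ne'
    have hpx : p k x ≠ 0 := right_ne_zero_of_mul (h0 ▸ (hpos x hx).ne')
    have htx : t k = x := by
      refine hmono.injOn (ht k hk) hx ?_
      rw [hratio k hk, h0, h1, mul_div_mul_right _ _ hpx]
    refine ⟨htx, ?_⟩
    rw [hcoeff k hk, htx, h0]
    field_simp
  have ha : a ∈ Set.Icc a b := Set.left_mem_Icc.2 hab.le
  have hb : b ∈ Set.Icc a b := Set.right_mem_Icc.2 hab.le
  obtain ⟨hta, hαa⟩ := hnode 0 n.zero_le a ha ((hβ a ha).trans (hB.sum_left β))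
    ((hγ a ha).trans (hB.sum_left γ))
  obtain ⟨htb, hαb⟩ := hnode n le_rfl b hb ((hβ b hb).trans (hB.sum_right β))
    ((hγ b hb).trans (hB.sum_right γ))
  exact ⟨hβpos, hta, htb, hratio, hcoeff, hαa, hαb⟩
end

section
/- Let n ≥ 1 and let U_n ⊂ U_{n+1} ⊂ C^{n+1}([a,b]) be linear subspaces of dimensions n+1 and n+2 possessing non-negative Bernstein bases p_{n,0},...,p_{n,n} and p_{n+1,0},...,p_{n+1,n+1}. Let (f_0, f_1) be a Haar pair with f_0, f_1 ∈ U_n. If there exists a Bernstein operator B_n : C[a,b] → U_n fixing f_0 and f_1 whose nodes are strictly increasing, a = t_{n,0} < t_{n,1} < ... < t_{n,n} = b, then there exists a Bernstein operator B_{n+1} : C[a,b] → U_{n+1} fixing f_0 and f_1 whose nodes t_{n+1,0},...,t_{n+1,n+1} are strictly increasing and strictly interlace with those of B_n: a = t_{n+1,0} = t_{n,0} < t_{n+1,1} < t_{n,1} < t_{n+1,2} < t_{n,2} < ... < t_{n+1,n} < t_{n,n} = t_{n+1,n+1} = b. -/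
open Finset

theorem eventually_neg_of_iteratedDeriv_neg (k : ℕ) {f : ℝ → ℝ} {a : ℝ} (hf : ContDiff ℝ k f)
    (h0 : ∀ i < k, iteratedDeriv i f a = 0) (hk : iteratedDeriv k f a < 0) :
    ∀ᶠ x in nhdsWithin a (Set.Ioi a), f x < 0 := by
  induction k generalizing f with
  | zero =>
    rw [iteratedDeriv_zero] at hk
    exact (hf.continuous.continuousAt.eventually_lt continuousAt_const hk).filter_mono
      nhdsWithin_le_nhds
  | succ k ih =>
    have hf' : ContDiff ℝ k (deriv f) := ContDiff.deriv' (by exact_mod_cast hf)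
    have hev := ih hf' (fun i hi => by rw [← iteratedDeriv_succ']; exact h0 _ (by omega))
      (by rwa [← iteratedDeriv_succ'])
    obtain ⟨c, hac, hc⟩ := mem_nhdsGT_iff_exists_Ioc_subset.1 hev
    have hfa : f a = 0 := by simpa using h0 0 (by omega)
    have hanti : StrictAntiOn f (Set.Icc a c) :=
      strictAntiOn_of_deriv_neg (convex_Icc a c) hf.continuous.continuousOn fun x hx => by
        rw [interior_Icc] at hx
        exact hc ⟨hx.1, hx.2.le⟩
    filter_upwards [Ioc_mem_nhdsGT hac] with x hx
    exact hfa ▸ hanti ⟨le_rfl, hac.le⟩ ⟨hx.1.le, hx.2⟩ hx.1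

theorem iteratedDeriv_left_nonneg {k : ℕ} {f : ℝ → ℝ} {a b : ℝ} (hab : a < b)
    (hf : ContDiff ℝ k f) (h0 : ∀ i < k, iteratedDeriv i f a = 0)
    (hpos : ∀ x ∈ Set.Icc a b, 0 ≤ f x) : 0 ≤ iteratedDeriv k f a := by
  by_contra! hk
  obtain ⟨x, hx, hxab⟩ :=
    ((eventually_neg_of_iteratedDeriv_neg k hf h0 hk).and (Ioc_mem_nhdsGT hab)).exists
  exact (hpos x ⟨hxab.1.le, hxab.2⟩).not_gt hx

theorem iteratedDeriv_right_nonneg {k : ℕ} {f : ℝ → ℝ} {a b : ℝ} (hab : a < b)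
    (hf : ContDiff ℝ k f) (h0 : ∀ i < k, iteratedDeriv i f b = 0)
    (hpos : ∀ x ∈ Set.Icc a b, 0 ≤ f x) : 0 ≤ (-1) ^ k * iteratedDeriv k f b := by
  have h := iteratedDeriv_left_nonneg (k := k) (f := fun x => f (-x)) (neg_lt_neg hab)
    (hf.comp contDiff_neg)
    (fun i hi => by rw [iteratedDeriv_comp_neg, neg_neg, h0 i hi, smul_zero])
    (fun x hx => hpos _ ⟨by linarith [hx.2], by linarith [hx.1]⟩)
  simpa [iteratedDeriv_comp_neg] using h

/-- Comparing derivatives at a point where the family `q` has zeros of increasing exact order. -/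
theorem coeff_of_triangular {m : ℕ} {x : ℝ} {q : ℕ → ℝ → ℝ}
    (hq : ∀ k ≤ m, ContDiff ℝ m (q k))
    (hlow : ∀ k ≤ m, ∀ i < k, iteratedDeriv i (q k) x = 0)
    (hdiag : ∀ k ≤ m, iteratedDeriv k (q k) x ≠ 0) (c : ℕ → ℝ) {f : ℝ → ℝ}
    (hf : f = fun y => ∑ i ∈ range (m + 1), c i * q i y) {k : ℕ}
    (h0 : ∀ i < k, iteratedDeriv i f x = 0) :
    (∀ j ≤ m, j < k → c j = 0) ∧
      (k ≤ m → iteratedDeriv k f x = c k * iteratedDeriv k (q k) x) := by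
  have key : ∀ j ≤ m, iteratedDeriv j f x = ∑ i ∈ range (m + 1), c i * iteratedDeriv j (q i) x := by
    intro j hj
    rw [hf, iteratedDeriv_fun_sum]
    · simp only [iteratedDeriv_const_mul_field]
    · intro i hi
      exact contDiffAt_const.mul
        (((hq i (by simpa [Nat.lt_succ_iff] using hi)).of_le (by exact_mod_cast hj)).contDiffAt)
  have single : ∀ j ≤ m, (∀ i < j, c i = 0) →
      iteratedDeriv j f x = c j * iteratedDeriv j (q j) x := by
    intro j hj hc
    rw [key j hj]
    refine Finset.sum_eq_single_of_mem j (by simp; omega) fun i hi hij => ?_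
    rcases lt_or_gt_of_ne hij with h | h
    · rw [hc i h, zero_mul]
    · rw [hlow i (by simpa [Nat.lt_succ_iff] using hi) j h, mul_zero]
  have hc : ∀ j ≤ m, j < k → c j = 0 := by
    intro j
    induction j using Nat.strong_induction_on with
    | _ j ih =>
      intro hj hjk
      have := single j hj fun i hi => ih i hi (by omega) (by omega)
      rw [h0 j hjk] at this
      exact (mul_eq_zero.1 this.symm).resolve_right (hdiag j hj)
  exact ⟨hc, fun hk => single k hk fun i hi => hc i (by omega) hi⟩

theorem exists_coeff_of_triangular {m : ℕ} {x : ℝ} {q : ℕ → ℝ → ℝ} {U : Submodule ℝ (ℝ → ℝ)}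
    (hdim : Module.finrank ℝ U = m + 1) (hqU : ∀ k ≤ m, q k ∈ U)
    (hq : ∀ k ≤ m, ContDiff ℝ m (q k))
    (hlow : ∀ k ≤ m, ∀ i < k, iteratedDeriv i (q k) x = 0)
    (hdiag : ∀ k ≤ m, iteratedDeriv k (q k) x ≠ 0) {f : ℝ → ℝ} (hf : f ∈ U) :
    ∃ c : ℕ → ℝ, f = fun y => ∑ i ∈ range (m + 1), c i * q i y := by
  let v : Fin (m + 1) → U := fun i => ⟨q i, hqU i (by omega)⟩
  have hli : LinearIndependent ℝ v := by
    rw [Fintype.linearIndependent_iff]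
    intro g hg i
    let c : ℕ → ℝ := fun j => if h : j < m + 1 then g ⟨j, h⟩ else 0
    have h0 : (0 : ℝ → ℝ) = fun y => ∑ i ∈ range (m + 1), c i * q i y := by
      have := congrArg (Subtype.val) hg
      funext y
      have := congrFun this y
      simpa [v, c, Finset.sum_range, Fin.is_le] using this.symm
    have := (coeff_of_triangular hq hlow hdiag c h0 (k := m + 1)
      (fun i _ => by simp)).1 i (by omega) (by omega)
    simpa [c, Fin.is_le] using this
  have hspan := hli.span_eq_top_of_card_eq_finrank (by simp [hdim])
  have hmem : (⟨f, hf⟩ : U) ∈ Submodule.span ℝ (Set.range v) := hspan ▸ Submodule.mem_top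
  obtain ⟨g, hg⟩ := (Submodule.mem_span_range_iff_exists_fun ℝ).1 hmem
  refine ⟨fun j => if h : j < m + 1 then g ⟨j, h⟩ else 0, ?_⟩
  funext y
  have := congrFun (congrArg Subtype.val hg) y
  simpa [v, Finset.sum_range, Fin.is_le] using this.symm

/-- Degree elevation: each `p k` is a positive combination of `q k` and `q (k + 1)`. -/
theorem IsNonnegBernsteinBasisOf.exists_elevation {n : ℕ} {a b : ℝ} (hab : a < b)
    {U V : Submodule ℝ (ℝ → ℝ)} (hUV : U ≤ V) (hdim : Module.finrank ℝ V = n + 2)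
    {p q : ℕ → ℝ → ℝ} (hp : IsNonnegBernsteinBasisOf n a b U p)
    (hq : IsNonnegBernsteinBasisOf (n + 1) a b V q) {k : ℕ} (hk : k ≤ n) :
    ∃ A B : ℝ, 0 < A ∧ 0 < B ∧ ∀ x, p k x = A * q k x + B * q (k + 1) x := by
  obtain ⟨⟨hpU, hpd, hpz⟩, hp0⟩ := hp
  obtain ⟨⟨hqV, hqd, hqz⟩, hq0⟩ := hq
  obtain ⟨c, hc⟩ := exists_coeff_of_triangular hdim hqV hqd (fun k hk => (hqz k hk).1)
    (fun k hk => (hqz k hk).2.1) (hUV (hpU k hk))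
  obtain ⟨hpa, hpa', hpb, hpb'⟩ := hpz k hk
  obtain ⟨hqa, hqa', -, -⟩ := hqz k (by omega)
  obtain ⟨-, -, hqb, hqb'⟩ := hqz (k + 1) (by omega)
  rw [show n + 1 - (k + 1) = n - k by omega] at hqb hqb'
  obtain ⟨hca, hcA⟩ := coeff_of_triangular hqd (fun k hk => (hqz k hk).1)
    (fun k hk => (hqz k hk).2.1) c hc hpa
  have hcr : p k = fun y => ∑ i ∈ range (n + 1 + 1), c (n + 1 - i) * q (n + 1 - i) y := by
    rw [hc]
    funext y
    rw [← Finset.sum_range_reflect]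
    simp
  obtain ⟨hcb, hcB⟩ := coeff_of_triangular (q := fun i => q (n + 1 - i))
    (fun i _ => hqd _ (by omega))
    (fun i hi j hj => (hqz (n + 1 - i) (by omega)).2.2.1 j (by omega))
    (fun i hi => by
      have := (hqz (n + 1 - i) (by omega)).2.2.2
      rwa [show n + 1 - (n + 1 - i) = i by omega] at this)
    (fun i => c (n + 1 - i)) hcr hpb
  have hA := hcA (by omega)
  have hB := hcB (by omega)
  simp only [show n + 1 - (n - k) = k + 1 by omega] at hB
  refine ⟨c k, c (k + 1), ?_, ?_, fun x => ?_⟩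
  · have h1 := (iteratedDeriv_left_nonneg hab ((hpd k hk).of_le (by exact_mod_cast hk)) hpa
      (hp0 k hk)).lt_of_ne' hpa'
    have h2 := iteratedDeriv_left_nonneg hab
      ((hqd k (by omega)).of_le (by exact_mod_cast (by omega : k ≤ n + 1))) hqa (hq0 k (by omega))
    exact pos_of_mul_pos_left (hA ▸ h1) h2
  · have hs : ((-1 : ℝ)) ^ (n - k) ≠ 0 := by simp
    have h1 := (iteratedDeriv_right_nonneg hab
      ((hpd k hk).of_le (by exact_mod_cast Nat.sub_le n k)) hpb
      (hp0 k hk)).lt_of_ne' (mul_ne_zero hs hpb')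
    have h2 := iteratedDeriv_right_nonneg hab
      ((hqd (k + 1) (by omega)).of_le (by exact_mod_cast (by omega : n - k ≤ n + 1))) hqb
      (hq0 (k + 1) (by omega))
    rw [hB, mul_left_comm] at h1
    exact pos_of_mul_pos_left h1 h2
  · rw [congrFun hc x, ← Finset.sum_subset (s₁ := {k, k + 1})]
    · rw [Finset.sum_pair (by omega)]
    · intro i hi
      simp only [mem_insert, mem_singleton, mem_range] at hi ⊢
      omega
    · intro i hi hi'
      simp only [mem_insert, mem_singleton, mem_range, not_or] at hi hi'
      rcases lt_or_gt_of_ne hi'.1 with h | h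
      · rw [hca i (by omega) h, zero_mul]
      · have := hcb (n + 1 - i) (by omega) (by omega)
        rw [show n + 1 - (n + 1 - i) = i by omega] at this
        rw [this, zero_mul]

/-- The coefficients in the family `q` of `∑ k ≤ n, c k • (A k • q k + B k • q (k + 1))`. -/
def elevate (n : ℕ) (A B c : ℕ → ℝ) (j : ℕ) : ℝ :=
  (if j ≤ n then c j * A j else 0) + (if 1 ≤ j then c (j - 1) * B (j - 1) else 0)

theorem sum_elevate (n : ℕ) (A B c q : ℕ → ℝ) :
    ∑ k ∈ range (n + 1), c k * (A k * q k + B k * q (k + 1)) =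
      ∑ j ∈ range (n + 1 + 1), elevate n A B c j * q j := by
  simp only [elevate, add_mul, Finset.sum_add_distrib, mul_add]
  congr 1
  · rw [Finset.sum_range_succ _ (n + 1), if_neg (by omega), zero_mul, add_zero]
    refine Finset.sum_congr rfl fun i hi => ?_
    rw [if_pos (by simpa [Nat.lt_succ_iff] using hi), mul_assoc]
  · rw [Finset.sum_range_succ' _ (n + 1)]
    simp [mul_assoc]

/-- inductive existence of the Bernstein operator at level n+1,
with strictly increasing and strictly interlacing nodes. -/
theorem bernstein_operator_extension
    (n : ℕ) (hn : 1 ≤ n) (a b : ℝ) (hab : a < b)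
    (Un Un1 : Submodule ℝ (ℝ → ℝ)) (hsub : Un ≤ Un1)
    (hdimn : Module.finrank ℝ Un = n + 1)
    (hdimn1 : Module.finrank ℝ Un1 = n + 2)
    (hsmooth : ∀ f ∈ Un1, ContDiff ℝ (n + 1) f)
    (p : ℕ → ℝ → ℝ) (hp : IsNonnegBernsteinBasisOf n a b Un p)
    (q : ℕ → ℝ → ℝ) (hq : IsNonnegBernsteinBasisOf (n + 1) a b Un1 q)
    (f0 f1 : ℝ → ℝ) (hf0U : f0 ∈ Un) (hf1U : f1 ∈ Un)
    (hHaar : IsHaarPair a b f0 f1)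
    (t : ℕ → ℝ) (α : ℕ → ℝ)
    (ht : ∀ k ≤ n, t k ∈ Set.Icc a b)
    (hα : ∀ k ≤ n, 0 < α k)
    (hfix0 : FixesOn a b (bernOp n p t α) f0)
    (hfix1 : FixesOn a b (bernOp n p t α) f1)
    (ht0 : t 0 = a) (htn : t n = b)
    (htmono : ∀ k < n, t k < t (k + 1)) :
    ∃ t' α' : ℕ → ℝ,
      (∀ k ≤ n + 1, t' k ∈ Set.Icc a b) ∧
      (∀ k ≤ n + 1, 0 < α' k) ∧
      FixesOn a b (bernOp (n + 1) q t' α') f0 ∧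
      FixesOn a b (bernOp (n + 1) q t' α') f1 ∧
      t' 0 = a ∧ t' (n + 1) = b ∧
      (∀ k < n + 1, t' k < t' (k + 1)) ∧
      (∀ k, 1 ≤ k → k ≤ n → t (k - 1) < t' k ∧ t' k < t k) := by
  obtain ⟨hc0, hc1, hpos, hmono⟩ := hHaar
  have hex := fun k (hk : k ≤ n) => hp.exists_elevation hab hsub hdimn1 hq hk
  choose! A B hA hB hpq using hex
  have hsum : ∀ (c : ℕ → ℝ) x, ∑ k ∈ range (n + 1), c k * p k x =
      ∑ j ∈ range (n + 1 + 1), elevate n A B c j * q j x := by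
    intro c x
    rw [← sum_elevate n A B c fun j => q j x]
    exact Finset.sum_congr rfl fun k hk => by rw [hpq k (by simpa [Nat.lt_succ_iff] using hk)]
  have hβ : ∀ k ≤ n, 0 < f0 (t k) * α k := fun k hk => mul_pos (hpos _ (ht k hk)) (hα k hk)
  set β' := elevate n A B fun k => f0 (t k) * α k with hβ'def
  set γ' := elevate n A B fun k => f1 (t k) * α k with hγ'def
  have hβ' : ∀ k ≤ n + 1, 0 < β' k := by
    intro k hk
    simp only [hβ'def, elevate]
    by_cases h1 : k ≤ n
    · rw [if_pos h1]
      have := mul_pos (hβ k h1) (hA k h1)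
      split_ifs
      · have := mul_pos (hβ (k - 1) (by omega)) (hB (k - 1) (by omega))
        positivity
      · simpa
    · rw [if_neg h1, if_pos (by omega), zero_add]
      exact mul_pos (hβ (k - 1) (by omega)) (hB (k - 1) (by omega))
  have hg : ContinuousOn (fun x => f1 x / f0 x) (Set.Icc a b) :=
    hc1.div hc0 fun x hx => (hpos x hx).ne'
  have hf1 : ∀ x ∈ Set.Icc a b, f1 x = f1 x / f0 x * f0 x := fun x hx =>
    (div_mul_cancel₀ _ (hpos x hx).ne').symm
  have hnode : ∀ k ≤ n + 1, ∃ s ∈ Set.Icc a b, f1 s / f0 s = γ' k / β' k ∧ (k = 0 → s = a) ∧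
      (k = n + 1 → s = b) ∧ (1 ≤ k → k ≤ n → t (k - 1) < s ∧ s < t k) := by
    intro k hk
    rcases Nat.eq_zero_or_pos k with rfl | hk0
    · refine ⟨a, ⟨le_rfl, hab.le⟩, ?_, by simp, by omega, by omega⟩
      have h1 := (hα 0 (by omega)).ne'
      have h2 := (hA 0 (by omega)).ne'
      simp only [hβ'def, hγ'def, elevate, ht0]
      simp [mul_div_mul_right _ _ h1, mul_div_mul_right _ _ h2]
    rcases hk.eq_or_lt with rfl | hkn
    · refine ⟨b, ⟨hab.le, le_rfl⟩, ?_, by omega, by simp, by omega⟩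
      have h1 := (hα n (by omega)).ne'
      have h2 := (hB n (by omega)).ne'
      simp only [hβ'def, hγ'def, elevate]
      simp [htn, mul_div_mul_right _ _ h1, mul_div_mul_right _ _ h2]
    obtain ⟨j, rfl⟩ : ∃ j, k = j + 1 := ⟨k - 1, by omega⟩
    have hj : j < n := by omega
    have hlt := htmono j hj
    have htj := ht j hj.le
    have htj' := ht (j + 1) hj
    have hu := mul_pos (hβ (j + 1) hj) (hA (j + 1) hj)
    have hv := mul_pos (hβ j hj.le) (hB j hj.le)
    have hglt := hmono htj htj' hlt
    simp only at hglt
    have hmem : γ' (j + 1) / β' (j + 1) ∈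
        Set.Ioo (f1 (t j) / f0 (t j)) (f1 (t (j + 1)) / f0 (t (j + 1))) := by
      have hb := hβ' (j + 1) hk
      have hval : ∀ r, γ' (j + 1) - r * β' (j + 1) =
          (f1 (t (j + 1)) / f0 (t (j + 1)) - r) * (f0 (t (j + 1)) * α (j + 1) * A (j + 1)) +
          (f1 (t j) / f0 (t j) - r) * (f0 (t j) * α j * B j) := by
        intro r
        have e : ∀ x ∈ Set.Icc a b, ∀ y z : ℝ,
            (f1 x / f0 x - r) * (f0 x * y * z) = f1 x * y * z - r * (f0 x * y * z) := by
          intro x hx y z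
          rw [hf1 x hx]
          have := (hpos x hx).ne'
          field_simp
        rw [e _ htj, e _ htj']
        simp only [hβ'def, hγ'def, elevate]
        simp [show j + 1 ≤ n by omega]
        ring
      refine ⟨(lt_div_iff₀ hb).2 (sub_pos.1 ?_), (div_lt_iff₀ hb).2 (sub_neg.1 ?_)⟩
      · rw [hval, sub_self, zero_mul, add_zero]
        exact mul_pos (sub_pos.2 hglt) hu
      · rw [hval, sub_self, zero_mul, zero_add]
        exact mul_neg_of_neg_of_pos (sub_neg.2 hglt) hv
    obtain ⟨s, hs, hs'⟩ := intermediate_value_Ioo hlt.le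
      (hg.mono (Set.Icc_subset_Icc htj.1 htj'.2)) hmem
    exact ⟨s, ⟨htj.1.trans hs.1.le, hs.2.le.trans htj'.2⟩, hs', by omega, by omega,
      fun _ _ => ⟨hs.1, hs.2⟩⟩
  choose! s hsI hsg hs0 hsn hsint using hnode
  have hs0' := hs0 0 (by omega) rfl
  have hsn' := hsn (n + 1) le_rfl rfl
  have hco0 : ∀ k ≤ n + 1, f0 (s k) * (β' k / f0 (s k)) = β' k := fun k hk =>
    mul_div_cancel₀ _ (hpos _ (hsI k hk)).ne'
  have hco1 : ∀ k ≤ n + 1, f1 (s k) * (β' k / f0 (s k)) = γ' k := fun k hk => by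
    rw [mul_div_left_comm, hsg k hk, mul_div_cancel₀ _ (hβ' k hk).ne']
  refine ⟨s, fun k => β' k / f0 (s k), hsI, fun k hk => div_pos (hβ' k hk) (hpos _ (hsI k hk)),
    fun x hx => ?_, fun x hx => ?_, hs0', hsn', fun k hk => ?_,
    fun k h1 hk => hsint k (by omega) h1 hk⟩
  · rw [← hfix0 x hx, bernOp, bernOp, hsum]
    exact Finset.sum_congr rfl fun k hk => by rw [hco0 k (by simpa [Nat.lt_succ_iff] using hk)]
  · rw [← hfix1 x hx, bernOp, bernOp, hsum]
    exact Finset.sum_congr rfl fun k hk => by rw [hco1 k (by simpa [Nat.lt_succ_iff] using hk)]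
  · have hlow : k = 0 ∧ s k = t 0 ∨ 1 ≤ k ∧ s k < t k := by
      rcases Nat.eq_zero_or_pos k with rfl | h
      · exact Or.inl ⟨rfl, by rw [hs0', ht0]⟩
      · exact Or.inr ⟨h, (hsint k (by omega) h (by omega)).2⟩
    have hle : s k ≤ t k := by
      rcases hlow with ⟨rfl, h⟩ | ⟨-, h⟩
      exacts [h.le, h.le]
    rcases (Nat.lt_succ_iff.1 hk).eq_or_lt with rfl | h
    · rcases hlow with ⟨rfl, -⟩ | ⟨-, h⟩
      · omega
      · rwa [hsn', ← htn]
    · exact hle.trans_lt (hsint (k + 1) (by omega) (by omega) h).1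
end

section
/- Let n ≥ 1 and let U_n be an extended Chebyshev space of dimension n+1 over [a,b]. Then there exist functions f_0, f_1 ∈ U_n forming a Haar pair (f_0 > 0 on [a,b] and f_1/f_0 strictly increasing on [a,b]) and a Bernstein operator B_n : C[a,b] → U_n with strictly increasing nodes fixing f_0 and f_1. -/
open Finset

open Set Filter Topology

theorem eventually_pos_nhdsGT_of_iteratedDeriv_pos {k : ℕ} {f : ℝ → ℝ} {a : ℝ}
    (hf : ContDiff ℝ k f) (hzero : ∀ i < k, iteratedDeriv i f a = 0)
    (hpos : 0 < iteratedDeriv k f a) : ∀ᶠ x in 𝓝[>] a, 0 < f x := by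
  induction k generalizing f with
  | zero =>
    rw [iteratedDeriv_zero] at hpos
    exact nhdsWithin_le_nhds (hf.continuous.continuousAt.eventually (lt_mem_nhds hpos))
  | succ k ih =>
    have hf' : ContDiff ℝ k (deriv f) := by
      have := hf
      push_cast at this
      exact (contDiff_succ_iff_deriv.1 this).2.2
    have hev := ih hf' (fun i hi => by
      rw [← iteratedDeriv_succ']; exact hzero _ (by omega)) (by rwa [← iteratedDeriv_succ'])
    obtain ⟨c, hc, hcpos⟩ := mem_nhdsGT_iff_exists_Ioo_subset.1 hev
    have hfa : f a = 0 := by simpa using hzero 0 (by omega)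
    have hmono : StrictMonoOn f (Ico a c) :=
      strictMonoOn_of_deriv_pos (convex_Ico a c) hf.continuous.continuousOn
        (by rw [interior_Ico]; exact fun x hx => hcpos hx)
    filter_upwards [Ioo_mem_nhdsGT hc] with x hx
    rw [← hfa]
    exact hmono ⟨le_rfl, hc⟩ ⟨hx.1.le, hx.2⟩ hx.1

theorem StrictMonoOn.Icc_of_Ioo {a b : ℝ} {f : ℝ → ℝ} (hf : ContinuousOn f (Icc a b))
    (h : StrictMonoOn f (Ioo a b)) : StrictMonoOn f (Icc a b) := by
  intro x hx y hy hxy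
  obtain ⟨u, hxu, huy⟩ := exists_between hxy
  obtain ⟨v, huv, hvy⟩ := exists_between huy
  have hu : u ∈ Ioo a b := ⟨hx.1.trans_lt hxu, huy.trans_le hy.2⟩
  have hv : v ∈ Ioo a b := ⟨hu.1.trans huv, hvy.trans_le hy.2⟩
  have hxu_le : f x ≤ f u :=
    ContinuousWithinAt.closure_le (s := Ioo x u) (by
      rw [closure_Ioo hxu.ne]; exact ⟨le_rfl, hxu.le⟩)
      ((hf x hx).mono fun z hz => ⟨hx.1.trans hz.1.le, hz.2.le.trans hu.2.le⟩)
      continuousWithinAt_const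
      fun z hz => (h ⟨hx.1.trans_lt hz.1, hz.2.trans hu.2⟩ hu hz.2).le
  have hvy_le : f v ≤ f y :=
    ContinuousWithinAt.closure_le (s := Ioo v y) (by
      rw [closure_Ioo hvy.ne]; exact ⟨hvy.le, le_rfl⟩)
      continuousWithinAt_const
      ((hf y hy).mono fun z hz => ⟨hv.1.le.trans hz.1.le, hz.2.le.trans hy.2⟩)
      fun z hz => (h hv ⟨hv.1.trans hz.1, hz.2.trans_le hy.2⟩ hz.1).le
  exact hxu_le.trans_lt ((h hu hv huv).trans_le hvy_le)

/-- Strict Chebyshev-type inequality: a family of functions whose consecutive ratios are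
increasing gives an increasing weighted mean of the index. -/
theorem sum_mul_sum_lt_of_ratio_lt {n : ℕ} (hn : 1 ≤ n) {u v : ℕ → ℝ}
    (hu : ∀ k ≤ n, 0 < u k) (hv : ∀ k ≤ n, 0 < v k)
    (h : ∀ k < n, u (k + 1) * v k < v (k + 1) * u k) :
    (∑ k ∈ range (n + 1), k * u k) * ∑ k ∈ range (n + 1), v k <
      (∑ k ∈ range (n + 1), k * v k) * ∑ k ∈ range (n + 1), u k := by
  have hlt : ∀ j k, j < k → k ≤ n → u k * v j < v k * u j := by
    intro j k hjk
    induction k, hjk using Nat.le_induction with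
    | base => exact fun hk => h j hk
    | succ k hjk ih =>
      intro hk
      have h1 := ih (by omega)
      have h2 := h k hk
      have hvk := hv k (by omega)
      have huk := hu k (by omega)
      have hvj := hv j (by omega)
      refine lt_of_mul_lt_mul_right ?_ (mul_pos huk hvk).le
      calc u (k + 1) * v j * (u k * v k) = (u k * v j) * (u (k + 1) * v k) := by ring
        _ < (v k * u j) * (v (k + 1) * u k) :=
          mul_lt_mul'' h1 h2 (mul_pos huk hvj).le (mul_pos (hu _ hk) hvk).le
        _ = v (k + 1) * u j * (u k * v k) := by ring
  have hnonneg : ∀ j ∈ range (n + 1), ∀ k ∈ range (n + 1),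
      0 ≤ ((k : ℝ) - j) * (v k * u j - u k * v j) := by
    intro j hj k hk
    rw [Finset.mem_range] at hj hk
    rcases lt_trichotomy j k with hjk | rfl | hjk
    · have : (j : ℝ) < k := by exact_mod_cast hjk
      exact mul_nonneg (by linarith) (by linarith [hlt j k hjk (by omega)])
    · simp
    · have : (k : ℝ) < j := by exact_mod_cast hjk
      exact mul_nonneg_of_nonpos_of_nonpos (by linarith) (by linarith [hlt k j hjk (by omega)])
  have hpos : 0 < ∑ j ∈ range (n + 1), ∑ k ∈ range (n + 1),
      ((k : ℝ) - j) * (v k * u j - u k * v j) := by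
    refine Finset.sum_pos' (fun j hj => Finset.sum_nonneg (hnonneg j hj))
      ⟨0, by simp, Finset.sum_pos' (hnonneg 0 (by simp)) ⟨1, by simp; omega, ?_⟩⟩
    have := hlt 0 1 one_pos hn
    simp
    linarith
  have hexp : ∑ j ∈ range (n + 1), ∑ k ∈ range (n + 1),
      ((k : ℝ) - j) * (v k * u j - u k * v j) =
      2 * ((∑ k ∈ range (n + 1), k * v k) * (∑ k ∈ range (n + 1), u k) -
        (∑ k ∈ range (n + 1), k * u k) * ∑ k ∈ range (n + 1), v k) := by
    have hterm : ∀ j k : ℕ, ((k : ℝ) - j) * (v k * u j - u k * v j) =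
        (u j * (k * v k) - v j * (k * u k)) + ((j * v j) * u k - (j * u j) * v k) := by
      intro j k; ring
    simp only [hterm, Finset.sum_add_distrib, Finset.sum_sub_distrib, ← Finset.mul_sum,
      ← Finset.sum_mul]
    ring
  linarith

namespace IsExtChebyshev

variable {n : ℕ} {a b : ℝ} {U : Submodule ℝ (ℝ → ℝ)}

theorem order_add_order_add_card_le (hU : IsExtChebyshev n a b U) (hab : a < b) {f : ℝ → ℝ}
    (hf : f ∈ U) (hf0 : f ≠ 0) {r s : ℕ} (hr : ∀ i < r, iteratedDeriv i f a = 0)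
    (hs : ∀ i < s, iteratedDeriv i f b = 0) {T : Finset ℝ} (hT : ∀ x ∈ T, x ∈ Ioo a b)
    (hTf : ∀ x ∈ T, f x = 0) : r + s + T.card ≤ n := by
  have haT : a ∉ T := fun h => (hT a h).1.false
  have hbT : b ∉ T := fun h => (hT b h).2.false
  have hμT : ∀ x ∈ T, (if x = a then r else if x = b then s else 1) = 1 := fun x hx => by
    rw [if_neg (hT x hx).1.ne', if_neg (hT x hx).2.ne]
  have key := hU.2.2 f hf hf0 (insert a (insert b T))
    (fun x => if x = a then r else if x = b then s else 1) ?_ ?_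
  · rw [Finset.sum_insert (by simp [haT, hab.ne]), Finset.sum_insert hbT,
      Finset.sum_congr rfl hμT] at key
    simp [hab.ne'] at key
    omega
  · intro x hx
    rcases Finset.mem_insert.1 hx with rfl | hx
    · exact ⟨le_rfl, hab.le⟩
    rcases Finset.mem_insert.1 hx with rfl | hx
    · exact ⟨hab.le, le_rfl⟩
    · exact Ioo_subset_Icc_self (hT x hx)
  · intro x hx
    rcases Finset.mem_insert.1 hx with rfl | hx
    · simpa using hr
    rcases Finset.mem_insert.1 hx with rfl | hx
    · simpa [hab.ne'] using hs
    · rw [hμT x hx]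
      intro i hi
      obtain rfl : i = 0 := by omega
      simpa using hTf x hx

theorem exists_ne_zero_of_order (hU : IsExtChebyshev n a b U) {k : ℕ} (hk : k ≤ n) :
    ∃ f ∈ U, f ≠ 0 ∧ (∀ i < k, iteratedDeriv i f a = 0) ∧
      ∀ i < n - k, iteratedDeriv i f b = 0 := by
  have : FiniteDimensional ℝ U := FiniteDimensional.of_finrank_pos (by rw [hU.1]; omega)
  have hsmooth : ∀ i ≤ n, ∀ (f : U) (x : ℝ), ContDiffAt ℝ i (f : ℝ → ℝ) x := fun i hi f x =>
    ((hU.2.1 f f.2).of_le (by exact_mod_cast hi)).contDiffAt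
  let L : U →ₗ[ℝ] (Fin k ⊕ Fin (n - k) → ℝ) :=
    { toFun := fun f => Sum.elim (fun i => iteratedDeriv i (f : ℝ → ℝ) a)
        (fun i => iteratedDeriv i (f : ℝ → ℝ) b)
      map_add' := fun f g => by
        ext (i | i) <;>
        exact iteratedDeriv_add (hsmooth _ (by omega) f _) (hsmooth _ (by omega) g _)
      map_smul' := fun c f => by
        ext (i | i) <;> exact iteratedDeriv_const_smul_field c _ }
  have hker : LinearMap.ker L ≠ ⊥ := LinearMap.ker_ne_bot_of_finrank_lt (by
    rw [hU.1, Module.finrank_fintype_fun_eq_card, Fintype.card_sum, Fintype.card_fin,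
      Fintype.card_fin]
    omega)
  obtain ⟨f, hf, hf0⟩ := (Submodule.ne_bot_iff _).1 hker
  have hL : L f = 0 := hf
  exact ⟨f, f.2, fun h => hf0 (Subtype.ext h), fun i hi => congrFun hL (Sum.inl ⟨i, hi⟩),
    fun i hi => congrFun hL (Sum.inr ⟨i, hi⟩)⟩

theorem exists_pos_of_order (hU : IsExtChebyshev n a b U) (hab : a < b) {k : ℕ} (hk : k ≤ n) :
    ∃ f ∈ U, ((∀ i < k, iteratedDeriv i f a = 0) ∧ iteratedDeriv k f a ≠ 0 ∧
      (∀ i < n - k, iteratedDeriv i f b = 0) ∧ iteratedDeriv (n - k) f b ≠ 0) ∧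
      ∀ x ∈ Ioo a b, 0 < f x := by
  obtain ⟨f, hfU, hf0, hfa, hfb⟩ := hU.exists_ne_zero_of_order hk
  have hfa' : iteratedDeriv k f a ≠ 0 := by
    intro h
    have := hU.order_add_order_add_card_le hab hfU hf0 (r := k + 1) (s := n - k)
      (Nat.forall_lt_succ_right.2 ⟨hfa, h⟩) hfb (T := ∅) (by simp) (by simp)
    simp at this
    omega
  have hfb' : iteratedDeriv (n - k) f b ≠ 0 := by
    intro h
    have := hU.order_add_order_add_card_le hab hfU hf0 (r := k) (s := n - k + 1)
      hfa (Nat.forall_lt_succ_right.2 ⟨hfb, h⟩) (T := ∅) (by simp) (by simp)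
    simp at this
    omega
  have hne : ∀ x ∈ Ioo a b, f x ≠ 0 := by
    intro x hx h
    have := hU.order_add_order_add_card_le hab hfU hf0 hfa hfb (T := {x}) (by simpa using hx)
      (by simpa using h)
    simp at this
    omega
  have hcont : ContinuousOn f (Ioo a b) := (hU.2.1 f hfU).continuous.continuousOn
  rcases isPreconnected_Ioo.mapsTo_Ioi_or_Iio hcont hne with h | h
  · exact ⟨f, hfU, ⟨hfa, hfa', hfb, hfb'⟩, h⟩
  · refine ⟨-f, U.neg_mem hfU, ?_, fun x hx => neg_pos.2 (h hx)⟩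
    simpa [iteratedDeriv_neg] using ⟨hfa, hfa', hfb, hfb'⟩

theorem ratio_strictMonoOn (hU : IsExtChebyshev n a b U) (hab : a < b) {k : ℕ} (hk : k < n)
    {p q : ℝ → ℝ} (hpU : p ∈ U) (hqU : q ∈ U)
    (hpa : ∀ i < k, iteratedDeriv i p a = 0) (hpa' : iteratedDeriv k p a ≠ 0)
    (hqa : ∀ i < k + 1, iteratedDeriv i q a = 0)
    (hpb : ∀ i < n - k, iteratedDeriv i p b = 0)
    (hqb : ∀ i < n - (k + 1), iteratedDeriv i q b = 0)
    (hp : ∀ x ∈ Ioo a b, 0 < p x) (hq : ∀ x ∈ Ioo a b, 0 < q x) :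
    StrictMonoOn (fun x => q x / p x) (Ioo a b) := by
  have hsmooth : ∀ i ≤ n, ∀ f ∈ U, ContDiff ℝ i f := fun i hi f hf =>
    (hU.2.1 f hf).of_le (by exact_mod_cast hi)
  have hderiv : ∀ (c : ℝ), ∀ i ≤ n, ∀ x, iteratedDeriv i (q - c • p) x =
      iteratedDeriv i q x - c * iteratedDeriv i p x := by
    intro c i hi x
    rw [iteratedDeriv_sub (hsmooth i hi q hqU).contDiffAt
      (hsmooth i hi _ (U.smul_mem c hpU)).contDiffAt, iteratedDeriv_const_smul_field, smul_eq_mul]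
  have hmem : ∀ c : ℝ, q - c • p ∈ U := fun c => U.sub_mem hqU (U.smul_mem c hpU)
  have hza : ∀ c : ℝ, ∀ i < k, iteratedDeriv i (q - c • p) a = 0 := fun c i hi => by
    rw [hderiv c i (by omega), hpa i hi, hqa i (by omega)]; simp
  have hzb : ∀ c : ℝ, ∀ i < n - (k + 1), iteratedDeriv i (q - c • p) b = 0 := fun c i hi => by
    rw [hderiv c i (by omega), hpb i (by omega), hqb i hi]; simp
  have hinj : InjOn (fun x => q x / p x) (Ioo a b) := by
    intro x hx y hy hxy
    by_contra hne
    set c := q x / p x with hc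
    have hcpos : 0 < c := div_pos (hq x hx) (hp x hx)
    have hx0 : q x = c * p x := (div_eq_iff (hp x hx).ne').1 hc.symm
    have hy0 : q y = c * p y := (div_eq_iff (hp y hy).ne').1 hxy.symm
    have hg0 : q - c • p ≠ 0 := by
      intro h
      have h1 := hderiv c k hk.le a
      rw [hqa k (by omega), h] at h1
      simp [iteratedDeriv_const_zero, hcpos.ne', hpa'] at h1
    have := hU.order_add_order_add_card_le hab (hmem c) hg0 (hza c) (hzb c) (T := {x, y})
      (by simpa using ⟨hx, hy⟩) (by simp [hx0, hy0])
    rw [Finset.card_pair hne] at this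
    omega
  have hcont : ContinuousOn (fun x => q x / p x) (Ioo a b) :=
    (hU.2.1 q hqU).continuous.continuousOn.div (hU.2.1 p hpU).continuous.continuousOn
      fun x hx => (hp x hx).ne'
  rcases hcont.strictMonoOn_of_injOn_Ioo hab hinj with h | h
  · exact h
  exfalso
  obtain ⟨m, hm⟩ := Set.nonempty_Ioo.2 hab
  set c := q m / p m with hc
  have hcpos : 0 < c := div_pos (hq m hm) (hp m hm)
  have hIoo : Ioo a m ∈ 𝓝[>] a := Ioo_mem_nhdsGT hm.1
  have hpk : 0 < iteratedDeriv k p a := by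
    refine hpa'.lt_or_gt.resolve_left fun hneg => ?_
    have hev := eventually_pos_nhdsGT_of_iteratedDeriv_pos (f := -p)
      (hsmooth k hk.le p hpU).neg (by simpa [iteratedDeriv_neg] using hpa)
      (by simpa [iteratedDeriv_neg] using hneg)
    obtain ⟨x, hx, hxm⟩ := (hev.and hIoo).exists
    have := hp x ⟨hxm.1, hxm.2.trans hm.2⟩
    simp at hx
    linarith
  have hev := eventually_pos_nhdsGT_of_iteratedDeriv_pos (k := k) (f := -(q - c • p)) (a := a)
    (hsmooth k hk.le _ (hmem c)).neg
    (fun i hi => by rw [iteratedDeriv_neg, hza c i hi, neg_zero])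
    (by rw [iteratedDeriv_neg, hderiv c k hk.le, hqa k (by omega)]; nlinarith)
  obtain ⟨x, hx, hxm⟩ := (hev.and hIoo).exists
  have hxI : x ∈ Ioo a b := ⟨hxm.1, hxm.2.trans hm.2⟩
  have hlt := (lt_div_iff₀ (hp x hxI)).1 (h hxI hm hxm.2)
  simp at hx
  linarith

end IsExtChebyshev

/-- any extended Chebyshev space admits a Haar pair and a Bernstein
operator with strictly increasing nodes fixing it. -/
theorem exists_haar_pair_and_bernstein_operator
    (n : ℕ) (hn : 1 ≤ n) (a b : ℝ) (hab : a < b)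
    (U : Submodule ℝ (ℝ → ℝ))
    (hU : IsExtChebyshev n a b U) :
    ∃ f0 f1 : ℝ → ℝ, f0 ∈ U ∧ f1 ∈ U ∧
      IsHaarPair a b f0 f1 ∧
      ∃ (p : ℕ → ℝ → ℝ) (t : ℕ → ℝ) (α : ℕ → ℝ),
        IsNonnegBernsteinBasisOf n a b U p ∧
        (∀ k ≤ n, t k ∈ Set.Icc a b) ∧
        (∀ k < n, t k < t (k + 1)) ∧
        (∀ k ≤ n, 0 < α k) ∧
        FixesOn a b (bernOp n p t α) f0 ∧
        FixesOn a b (bernOp n p t α) f1 := by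
  have hex : ∀ k, ∃ f : ℝ → ℝ, k ≤ n → f ∈ U ∧ ((∀ i < k, iteratedDeriv i f a = 0) ∧
      iteratedDeriv k f a ≠ 0 ∧ (∀ i < n - k, iteratedDeriv i f b = 0) ∧
      iteratedDeriv (n - k) f b ≠ 0) ∧ ∀ x ∈ Ioo a b, 0 < f x := by
    intro k
    by_cases hk : k ≤ n
    · obtain ⟨f, hf⟩ := hU.exists_pos_of_order hab hk
      exact ⟨f, fun _ => hf⟩
    · exact ⟨0, fun h => absurd h hk⟩
  choose p hp using hex
  have hpU : ∀ k ≤ n, p k ∈ U := fun k hk => (hp k hk).1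
  have hpos : ∀ k ≤ n, ∀ x ∈ Ioo a b, 0 < p k x := fun k hk => (hp k hk).2.2
  have hcont : ∀ k ≤ n, Continuous (p k) := fun k hk => (hU.2.1 _ (hpU k hk)).continuous
  have hnonneg : ∀ k ≤ n, ∀ x ∈ Icc a b, 0 ≤ p k x := by
    intro k hk x hx
    rw [← closure_Ioo hab.ne] at hx
    exact ContinuousWithinAt.closure_le hx continuousWithinAt_const
      (hcont k hk).continuousWithinAt fun y hy => (hpos k hk y hy).le
  have hpa : ∀ k ≤ n, 0 < k → p k a = 0 := fun k hk h => by
    simpa using (hp k hk).2.1.1 0 h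
  have hpb : ∀ k < n, p k b = 0 := fun k hk => by
    simpa using (hp k hk.le).2.1.2.2.1 0 (by omega)
  have hpa0 : 0 < p 0 a := (hnonneg 0 (by omega) a ⟨le_rfl, hab.le⟩).lt_of_ne' (by
    simpa using (hp 0 (by omega)).2.1.2.1)
  have hpbn : 0 < p n b := (hnonneg n le_rfl b ⟨hab.le, le_rfl⟩).lt_of_ne' (by
    simpa using (hp n le_rfl).2.1.2.2.2)
  have hle : ∀ {k}, k ∈ range (n + 1) → k ≤ n := fun hk =>
    Nat.lt_succ_iff.1 (Finset.mem_range.1 hk)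
  set f0 : ℝ → ℝ := ∑ k ∈ range (n + 1), p k with hf0
  set f1 : ℝ → ℝ := ∑ k ∈ range (n + 1), (k : ℝ) • p k with hf1
  have hf0x : ∀ x, f0 x = ∑ k ∈ range (n + 1), p k x := fun x => by simp [hf0]
  have hf1x : ∀ x, f1 x = ∑ k ∈ range (n + 1), k * p k x := fun x => by simp [hf1]
  have hf0U : f0 ∈ U := U.sum_mem fun k hk => hpU k (hle hk)
  have hf1U : f1 ∈ U := U.sum_mem fun k hk => U.smul_mem _ (hpU k (hle hk))
  have hf0c : Continuous f0 := (hU.2.1 _ hf0U).continuous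
  have hf1c : Continuous f1 := (hU.2.1 _ hf1U).continuous
  have hf0pos : ∀ x ∈ Icc a b, 0 < f0 x := by
    intro x hx
    rw [hf0x]
    refine Finset.sum_pos' (fun k hk => hnonneg k (hle hk) x hx) ?_
    rcases hx.1.eq_or_lt with rfl | hax
    · exact ⟨0, by simp, hpa0⟩
    rcases hx.2.eq_or_lt with rfl | hxb
    · exact ⟨n, by simp, hpbn⟩
    · exact ⟨0, by simp, hpos 0 (by omega) x ⟨hax, hxb⟩⟩
  have hquot : ContinuousOn (fun x => f1 x / f0 x) (Icc a b) :=
    hf1c.continuousOn.div hf0c.continuousOn fun x hx => (hf0pos x hx).ne'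
  have hmono : StrictMonoOn (fun x => f1 x / f0 x) (Icc a b) := by
    refine StrictMonoOn.Icc_of_Ioo hquot fun x hx y hy hxy => ?_
    refine (div_lt_div_iff₀ (hf0pos x (Ioo_subset_Icc_self hx))
      (hf0pos y (Ioo_subset_Icc_self hy))).2 ?_
    simp only [hf0x, hf1x]
    refine sum_mul_sum_lt_of_ratio_lt hn (fun k hk => hpos k hk x hx)
      (fun k hk => hpos k hk y hy) fun k hk => ?_
    obtain ⟨hkU, ⟨hka, hka', hkb, -⟩, -⟩ := hp k hk.le
    obtain ⟨hkU', ⟨hla, -, hlb, -⟩, -⟩ := hp (k + 1) hk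
    exact (div_lt_div_iff₀ (hpos k hk.le x hx) (hpos k hk.le y hy)).1
      (hU.ratio_strictMonoOn hab hk hkU hkU' hka hka' hla hkb hlb (hpos k hk.le)
        (hpos (k + 1) hk) hx hy hxy)
  have hra : f1 a / f0 a = 0 := by
    rw [hf1x, Finset.sum_eq_zero, zero_div]
    intro k hk
    rcases k.eq_zero_or_pos with rfl | h
    · simp
    · rw [hpa k (hle hk) h, mul_zero]
  have hrb : f1 b / f0 b = n := by
    have h0 : ∀ k ∈ range n, p k b = 0 := fun k hk => hpb k (Finset.mem_range.1 hk)
    rw [hf1x, hf0x, Finset.sum_range_succ, Finset.sum_range_succ, Finset.sum_eq_zero h0,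
      Finset.sum_eq_zero fun k hk => by rw [h0 k hk, mul_zero], zero_add, zero_add,
      mul_div_cancel_right₀ _ hpbn.ne']
  have hnode : ∀ k : ℕ, ∃ t, k ≤ n → t ∈ Icc a b ∧ f1 t / f0 t = k := by
    intro k
    by_cases hk : k ≤ n
    · obtain ⟨t, ht, hkt⟩ := intermediate_value_Icc hab.le hquot (show (k : ℝ) ∈ _ by
        rw [hra, hrb]; exact ⟨k.cast_nonneg, by exact_mod_cast hk⟩)
      exact ⟨t, fun _ => ⟨ht, hkt⟩⟩
    · exact ⟨0, fun h => absurd h hk⟩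
  choose t ht using hnode
  refine ⟨f0, f1, hf0U, hf1U, ⟨hf0c.continuousOn, hf1c.continuousOn, hf0pos, hmono⟩, p, t,
    fun k => (f0 (t k))⁻¹, ⟨⟨hpU, fun k hk => hU.2.1 _ (hpU k hk), fun k hk => (hp k hk).2.1⟩,
      hnonneg⟩, fun k hk => (ht k hk).1, fun k hk => ?_,
    fun k hk => inv_pos.2 (hf0pos _ (ht k hk).1), fun x _ => ?_, fun x _ => ?_⟩
  · refine (hmono.lt_iff_lt (ht k hk.le).1 (ht (k + 1) hk).1).1 ?_
    simp only [(ht k hk.le).2, (ht (k + 1) hk).2]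
    exact_mod_cast k.lt_succ_self
  · rw [hf0x]
    refine Finset.sum_congr rfl fun k hk => ?_
    rw [mul_inv_cancel₀ (hf0pos _ (ht k (hle hk)).1).ne', one_mul]
  · rw [hf1x]
    refine Finset.sum_congr rfl fun k hk => ?_
    rw [← div_eq_mul_inv, (ht k (hle hk)).2]
end

section
/- Fix an integer j > 1 and for n ≥ j define the operator B_{n,0,j} : C[0,1] → (polynomials of degree ≤ n) by B_{n,0,j} f(x) = Σ_{k=0}^n f( (k(k−1)···(k−j+1) / (n(n−1)···(n−j+1)))^{1/j} ) · C(n,k) x^k (1−x)^{n−k}, where for 0 ≤ k < j the node is 0. Then B_{n,0,j} fixes the functions 1 and x^j (i.e. B_{n,0,j} 1 = 1 and B_{n,0,j} x^j = x^j on [0,1]), and for every f ∈ C[0,1], B_{n,0,j} f converges uniformly to f on [0,1] as n → ∞. -/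
open Finset Filter

/-- The node `t_{n,k} = (k(k−1)⋯(k−j+1)/(n(n−1)⋯(n−j+1)))^{1/j}`;
for `k < j` the falling factorial vanishes, so the node is `0`. -/
noncomputable def bNode (j n k : ℕ) : ℝ :=
  ((∏ i ∈ Finset.range j, ((k : ℝ) - (i : ℝ))) /
    (∏ i ∈ Finset.range j, ((n : ℝ) - (i : ℝ)))) ^ ((1 : ℝ) / (j : ℝ))

/-- The generalized Bernstein operator `B_{n,0,j}` on `C[0,1]` fixing `1` and `x^j`. -/
noncomputable def B0j (j n : ℕ) (f : ℝ → ℝ) : ℝ → ℝ :=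
  fun x => ∑ k ∈ Finset.range (n + 1),
    f (bNode j n k) * (n.choose k : ℝ) * x ^ k * (1 - x) ^ (n - k)

theorem prod_range_natCast_sub_eq_descFactorial (k j : ℕ) :
    ∏ i ∈ Finset.range j, ((k : ℝ) - (i : ℝ)) = (k.descFactorial j : ℝ) := by
  induction j with
  | zero => simp
  | succ j ih =>
    rw [Finset.prod_range_succ, ih, Nat.descFactorial_succ]
    rcases le_or_gt j k with h | h
    · push_cast [Nat.cast_sub h]
      ring
    · simp [Nat.descFactorial_eq_zero_iff_lt.2 h]

theorem bNode_eq (j n k : ℕ) :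
    bNode j n k = ((k.descFactorial j : ℝ) / n.descFactorial j) ^ ((1 : ℝ) / (j : ℝ)) := by
  simp only [bNode, prod_range_natCast_sub_eq_descFactorial]

theorem bNode_nonneg (j n k : ℕ) : 0 ≤ bNode j n k := by
  rw [bNode_eq]
  positivity

theorem bNode_pow {j : ℕ} (hj : j ≠ 0) (n k : ℕ) :
    bNode j n k ^ j = (k.descFactorial j : ℝ) / n.descFactorial j := by
  rw [bNode_eq, one_div, Real.rpow_inv_natCast_pow (by positivity) hj]

theorem sum_choose_mul_pow_mul_one_sub_pow (n : ℕ) (x : ℝ) :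
    ∑ k ∈ Finset.range (n + 1), (n.choose k : ℝ) * x ^ k * (1 - x) ^ (n - k) = 1 := by
  have h := add_pow x (1 - x) n
  rw [add_sub_cancel, one_pow] at h
  refine Eq.trans (Finset.sum_congr rfl fun k _ => ?_) h.symm
  ring

theorem descFactorial_mul_choose (m j k : ℕ) :
    (j + k).descFactorial j * (m + j).choose (j + k) =
      (m + j).descFactorial j * m.choose k := by
  rcases le_or_gt k m with h | h
  · have key := Nat.choose_mul (n := m + j) (k := j + k) (s := j) (by omega)
    rw [Nat.add_sub_cancel, Nat.add_sub_cancel_left] at key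
    rw [Nat.descFactorial_eq_factorial_mul_choose, Nat.descFactorial_eq_factorial_mul_choose,
      mul_assoc, mul_assoc, ← key, mul_comm ((j + k).choose j)]
  · rw [Nat.choose_eq_zero_of_lt h, Nat.choose_eq_zero_of_lt (by omega), mul_zero, mul_zero]

theorem B0j_one (j n : ℕ) (x : ℝ) : B0j j n (fun _ => (1 : ℝ)) x = 1 := by
  simpa [B0j] using sum_choose_mul_pow_mul_one_sub_pow n x

theorem B0j_pow {j n : ℕ} (hj : j ≠ 0) (hn : j ≤ n) (x : ℝ) :
    B0j j n (fun y => y ^ j) x = x ^ j := by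
  obtain ⟨m, rfl⟩ := Nat.exists_eq_add_of_le' hn
  have hd : ((m + j).descFactorial j : ℝ) ≠ 0 := by
    exact_mod_cast (Nat.descFactorial_pos.2 hn).ne'
  simp only [B0j, bNode_pow hj]
  rw [show m + j + 1 = j + (m + 1) by ring, Finset.sum_range_add,
    Finset.sum_eq_zero fun k hk => ?_, zero_add]
  · calc
      _ = ∑ k ∈ Finset.range (m + 1),
            x ^ j * ((m.choose k : ℝ) * x ^ k * (1 - x) ^ (m - k)) := by
        refine Finset.sum_congr rfl fun k _ => ?_
        have h : ((j + k).descFactorial j : ℝ) * (m + j).choose (j + k) =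
            (m + j).descFactorial j * m.choose k := by
          exact_mod_cast descFactorial_mul_choose m j k
        rw [div_mul_eq_mul_div, h, mul_div_cancel_left₀ _ hd, pow_add,
          show m + j - (j + k) = m - k by omega]
        ring
      _ = x ^ j := by
        rw [← Finset.mul_sum, sum_choose_mul_pow_mul_one_sub_pow, mul_one]
  · simp [Nat.descFactorial_eq_zero_iff_lt.2 (Finset.mem_range.1 hk)]

theorem bNode_le_div {j n k : ℕ} (hj : j ≠ 0) (hk : k ≤ n) :
    bNode j n k ≤ (k : ℝ) / n := by
  rcases lt_or_ge k j with hkj | hkj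
  · have h : bNode j n k ^ j = 0 := by
      rw [bNode_pow hj, Nat.descFactorial_eq_zero_iff_lt.2 hkj, Nat.cast_zero, zero_div]
    rw [eq_zero_of_pow_eq_zero h]
    positivity
  · refine le_of_pow_le_pow_left₀ hj (by positivity) ?_
    rw [bNode_pow hj, ← prod_range_natCast_sub_eq_descFactorial,
      ← prod_range_natCast_sub_eq_descFactorial, ← Finset.prod_div_distrib]
    calc
      _ ≤ ∏ _i ∈ Finset.range j, (k : ℝ) / n := by
        refine Finset.prod_le_prod (fun i hi => ?_) fun i hi => ?_
        all_goals
          have hij : (i : ℝ) < j := by exact_mod_cast Finset.mem_range.1 hi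
          have hkj' : (j : ℝ) ≤ k := by exact_mod_cast hkj
          have hkn : (k : ℝ) ≤ n := by exact_mod_cast hk
          have hi0 : (0 : ℝ) ≤ i := by positivity
        · exact div_nonneg (by linarith) (by linarith)
        · rw [div_le_div_iff₀ (by linarith) (by linarith)]
          nlinarith
      _ = _ := by rw [Finset.prod_const, Finset.card_range]

theorem sub_div_le_bNode {j n k : ℕ} (hj : j ≠ 0) (hk : k ≤ n) :
    ((k : ℝ) - j) / n ≤ bNode j n k := by
  rcases lt_or_ge k j with hkj | hkj
  · have hkj' : (k : ℝ) < j := by exact_mod_cast hkj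
    exact (div_nonpos_of_nonpos_of_nonneg (by linarith) (by positivity)).trans
      (bNode_nonneg j n k)
  · refine le_of_pow_le_pow_left₀ hj (bNode_nonneg j n k) ?_
    rw [bNode_pow hj, ← prod_range_natCast_sub_eq_descFactorial,
      ← prod_range_natCast_sub_eq_descFactorial, ← Finset.prod_div_distrib]
    have hkj' : (j : ℝ) ≤ k := by exact_mod_cast hkj
    have hkn : (k : ℝ) ≤ n := by exact_mod_cast hk
    calc
      _ = ∏ _i ∈ Finset.range j, ((k : ℝ) - j) / n := by
        rw [Finset.prod_const, Finset.card_range]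
      _ ≤ _ := by
        refine Finset.prod_le_prod
          (fun i _ => div_nonneg (by linarith) (by positivity)) fun i hi => ?_
        have hij : (i : ℝ) < j := by exact_mod_cast Finset.mem_range.1 hi
        have hi0 : (0 : ℝ) ≤ i := by positivity
        rw [div_le_div_iff₀ (by linarith) (by linarith)]
        nlinarith

theorem abs_bNode_sub_div_le {j n k : ℕ} (hj : j ≠ 0) (hk : k ≤ n) :
    |bNode j n k - (k : ℝ) / n| ≤ (j : ℝ) / n := by
  have h₁ := bNode_le_div hj hk
  have h₂ := sub_div_le_bNode hj hk
  rw [sub_div] at h₂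
  have h₃ : (0 : ℝ) ≤ (j : ℝ) / n := by positivity
  rw [abs_le]
  constructor <;> linarith

theorem tendstoUniformlyOn_classical_bernstein {f : ℝ → ℝ}
    (hf : ContinuousOn f (Set.Icc (0 : ℝ) 1)) :
    TendstoUniformlyOn (fun (n : ℕ) x => ∑ k ∈ Finset.range (n + 1),
      f ((k : ℝ) / n) * (n.choose k : ℝ) * x ^ k * (1 - x) ^ (n - k))
      f atTop (Set.Icc (0 : ℝ) 1) := by
  have h := bernsteinApproximation_uniform
    (⟨fun x => f x, continuousOn_iff_continuous_domRestrict.1 hf⟩ : C(unitInterval, ℝ))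
  rw [ContinuousMap.tendsto_iff_tendstoUniformly, Metric.tendstoUniformly_iff] at h
  rw [Metric.tendstoUniformlyOn_iff]
  intro ε hε
  filter_upwards [h ε hε] with n hn x hx
  refine lt_of_eq_of_lt (congrArg (dist (f x)) ?_) (hn ⟨x, hx⟩)
  rw [bernsteinApproximation.apply, Finset.sum_range]
  refine Finset.sum_congr rfl fun k _ => ?_
  rw [bernstein_apply, smul_eq_mul]
  change _ = _ * f ((k : ℝ) / n)
  ring

theorem dist_B0j_classical_bernstein_le {f : ℝ → ℝ} {j n : ℕ} {ε x : ℝ}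
    (hx : x ∈ Set.Icc (0 : ℝ) 1)
    (h : ∀ k ≤ n, |f (bNode j n k) - f ((k : ℝ) / n)| ≤ ε) :
    |B0j j n f x - ∑ k ∈ Finset.range (n + 1),
      f ((k : ℝ) / n) * (n.choose k : ℝ) * x ^ k * (1 - x) ^ (n - k)| ≤ ε := by
  have hx₀ := hx.1
  have hx₁ : 0 ≤ 1 - x := sub_nonneg.2 hx.2
  rw [B0j, ← Finset.sum_sub_distrib]
  calc
    _ ≤ ∑ k ∈ Finset.range (n + 1), ε * ((n.choose k : ℝ) * x ^ k * (1 - x) ^ (n - k)) := by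
      refine (Finset.abs_sum_le_sum_abs _ _).trans (Finset.sum_le_sum fun k hk => ?_)
      have hb : 0 ≤ (n.choose k : ℝ) * x ^ k * (1 - x) ^ (n - k) := by positivity
      calc
        _ = |(f (bNode j n k) - f ((k : ℝ) / n)) *
              ((n.choose k : ℝ) * x ^ k * (1 - x) ^ (n - k))| := by
          congr 1
          ring
        _ ≤ _ := by
          rw [abs_mul, abs_of_nonneg hb]
          exact mul_le_mul_of_nonneg_right (h k (Nat.lt_succ_iff.1 (Finset.mem_range.1 hk))) hb
    _ = ε := by rw [← Finset.mul_sum, sum_choose_mul_pow_mul_one_sub_pow, mul_one]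

/-- `B_{n,0,j}` fixes `1` and `x^j`, and `B_{n,0,j} f → f`
uniformly on `[0,1]` for every continuous `f`. -/
theorem B0j_fixes_and_converges (j : ℕ) (hj : 1 < j) :
    (∀ n, j ≤ n → ∀ x ∈ Set.Icc (0 : ℝ) 1,
      B0j j n (fun _ => (1 : ℝ)) x = 1 ∧ B0j j n (fun y => y ^ j) x = x ^ j) ∧
    (∀ f : ℝ → ℝ, ContinuousOn f (Set.Icc (0 : ℝ) 1) →
      TendstoUniformlyOn (fun n x => B0j j n f x) f atTop (Set.Icc (0 : ℝ) 1)) := by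
  have hj0 : j ≠ 0 := by omega
  refine ⟨fun n hn x _ => ⟨B0j_one j n x, B0j_pow hj0 hn x⟩, fun f hf => ?_⟩
  rw [Metric.tendstoUniformlyOn_iff]
  intro ε hε
  obtain ⟨δ, hδ, hfδ⟩ := Metric.uniformContinuousOn_iff.1
    (isCompact_Icc.uniformContinuousOn_of_continuous hf) (ε / 2) (half_pos hε)
  filter_upwards [Metric.tendstoUniformlyOn_iff.1 (tendstoUniformlyOn_classical_bernstein hf)
      (ε / 2) (half_pos hε),
    (tendsto_const_div_atTop_nhds_zero_nat (j : ℝ)).eventually_lt_const hδ]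
    with n hn hnδ x hx
  have hclose := dist_B0j_classical_bernstein_le (f := f) (j := j) (n := n) (ε := ε / 2) hx
    fun k hk => by
      have hk1 : (k : ℝ) / n ≤ 1 :=
        div_le_one_of_le₀ (by exact_mod_cast hk) (by positivity)
      refine (hfδ _ ⟨bNode_nonneg j n k, (bNode_le_div hj0 hk).trans hk1⟩ _
        ⟨by positivity, hk1⟩ ?_).le
      exact (abs_bNode_sub_div_le hj0 hk).trans_lt hnδ
  rw [← Real.dist_eq, dist_comm] at hclose
  exact (dist_triangle _ _ _).trans_lt ((add_lt_add_of_lt_of_le (hn x hx) hclose).trans_eq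
    (add_halves ε))
end

section
/- For every integer j ≥ 1, every integer n ≥ j, and every real x, one has x^j = Σ_{k=j}^{n} (k(k−1)···(k−j+1) / (n(n−1)···(n−j+1))) · C(n,k) x^k (1−x)^{n−k}; equivalently, the coordinates of x^j in the Bernstein basis C(n,k) x^k (1−x)^{n−k} are γ_{n,k} = k(k−1)···(k−j+1)/(n(n−1)···(n−j+1)) for j ≤ k ≤ n and γ_{n,k} = 0 for 0 ≤ k < j. -/
open Finset

theorem prod_range_cast_sub_eq_factorial_mul_choose {R : Type*} [CommRing R] (m j : ℕ) :
    ∏ i ∈ Finset.range j, ((m : R) - (i : R)) = (j.factorial : R) * (m.choose j : R) := by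
  rw [← descPochhammer_eval_eq_prod_range, descPochhammer_eval_eq_descFactorial,
    Nat.descFactorial_eq_factorial_mul_choose, Nat.cast_mul]

/-- the coordinates of `x^j` in the classical Bernstein basis:
`x^j = Σ_{k=j}^{n} (k(k−1)⋯(k−j+1)/(n(n−1)⋯(n−j+1))) C(n,k) x^k (1−x)^{n−k}`
(the coefficient for `k < j` being zero, as the falling factorial vanishes there). -/
theorem bernstein_coordinates_of_pow (j n : ℕ) (hj : 1 ≤ j) (hn : j ≤ n) (x : ℝ) :
    x ^ j = ∑ k ∈ Finset.Icc j n,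
      ((∏ i ∈ Finset.range j, ((k : ℝ) - (i : ℝ))) /
        (∏ i ∈ Finset.range j, ((n : ℝ) - (i : ℝ)))) *
        (n.choose k : ℝ) * x ^ k * (1 - x) ^ (n - k) := by
  have hbinom : ∑ m ∈ Finset.range (n - j + 1),
      x ^ m * (1 - x) ^ (n - j - m) * ((n - j).choose m : ℝ) = 1 := by
    rw [← add_pow, add_sub_cancel, one_pow]
  rw [← Finset.Ico_add_one_right_eq_Icc, Finset.sum_Ico_eq_sum_range, Nat.sub_add_comm hn]
  conv_lhs => rw [← mul_one (x ^ j), ← hbinom, Finset.mul_sum]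
  refine Finset.sum_congr rfl fun m _ => ?_
  have hchoose : (n.choose (j + m) : ℝ) * ((j + m).choose j : ℝ) =
      (n.choose j : ℝ) * ((n - j).choose m : ℝ) := by
    have := Nat.choose_mul (n := n) (Nat.le_add_right j m)
    rw [Nat.add_sub_cancel_left] at this
    exact_mod_cast this
  have hfac : (j.factorial : ℝ) ≠ 0 := by positivity
  have hnj : (n.choose j : ℝ) ≠ 0 := by exact_mod_cast (Nat.choose_pos hn).ne'
  have hcoeff : (j.factorial : ℝ) * ((j + m).choose j : ℝ) / (j.factorial * n.choose j) *
      (n.choose (j + m) : ℝ) = ((n - j).choose m : ℝ) := by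
    rw [mul_div_mul_left _ _ hfac, div_mul_eq_mul_div, div_eq_iff hnj]
    linarith
  rw [prod_range_cast_sub_eq_factorial_mul_choose, prod_range_cast_sub_eq_factorial_mul_choose,
    hcoeff, pow_add, Nat.sub_sub]
  ring
end

section
/- Let (f_0, f_1) be a Haar pair on [a,b]. For a ≤ x_0 < x_2 ≤ b and f : [a,b] → ℝ, let ψ^f_{x_0,x_2} denote the unique function in the span of f_0 and f_1 with ψ^f_{x_0,x_2}(x_0) = f(x_0) and ψ^f_{x_0,x_2}(x_2) = f(x_2). Then f is (f_0,f_1)-convex if and only if for all x_0 < x < x_2 in [a,b] one has f(x) ≤ ψ^f_{x_0,x_2}(x); and in that case, for all y ∈ [a,b] \ [x_0,x_2] one has f(y) ≥ ψ^f_{x_0,x_2}(y). -/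
open Finset

theorem IsHaarPair.wronskian_pos {a b : ℝ} {f0 f1 : ℝ → ℝ} (h : IsHaarPair a b f0 f1) {x y : ℝ}
    (hx : x ∈ Set.Icc a b) (hy : y ∈ Set.Icc a b) (hxy : x < y) :
    0 < f0 x * f1 y - f0 y * f1 x := by
  obtain ⟨-, -, hpos, hmono⟩ := h
  have hlt := hmono hx hy hxy
  simp only [div_lt_div_iff₀ (hpos x hx) (hpos y hy)] at hlt
  linarith

/-- Subtracting an element of the span of the first two rows from the third row, and expanding. -/
theorem det_eq_sub_span (f0 f1 f : ℝ → ℝ) (c d x0 x1 x2 : ℝ) :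
    Matrix.det !![f0 x0, f0 x1, f0 x2; f1 x0, f1 x1, f1 x2; f x0, f x1, f x2] =
      (f x0 - (c * f0 x0 + d * f1 x0)) * (f0 x1 * f1 x2 - f0 x2 * f1 x1) -
      (f x1 - (c * f0 x1 + d * f1 x1)) * (f0 x0 * f1 x2 - f0 x2 * f1 x0) +
      (f x2 - (c * f0 x2 + d * f1 x2)) * (f0 x0 * f1 x1 - f0 x1 * f1 x0) := by
  simp [Matrix.det_fin_three]
  ring

theorem IsHaarPair.exists_interpolant {a b : ℝ} {f0 f1 : ℝ → ℝ} (h : IsHaarPair a b f0 f1)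
    {x y : ℝ} (hx : x ∈ Set.Icc a b) (hy : y ∈ Set.Icc a b) (hxy : x < y) (u v : ℝ) :
    ∃ c d : ℝ, c * f0 x + d * f1 x = u ∧ c * f0 y + d * f1 y = v := by
  have hW := (h.wronskian_pos hx hy hxy).ne'
  refine ⟨(u * f1 y - v * f1 x) / (f0 x * f1 y - f0 y * f1 x),
    (v * f0 x - u * f0 y) / (f0 x * f1 y - f0 y * f1 x), ?_, ?_⟩
  · rw [div_mul_eq_mul_div, div_mul_eq_mul_div, ← add_div, div_eq_iff hW]
    ring
  · rw [div_mul_eq_mul_div, div_mul_eq_mul_div, ← add_div, div_eq_iff hW]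
    ring

/-- characterization of (f0,f1)-convexity via the generalized chord
ψ (the unique element of span{f0,f1} interpolating f at x0 and x2, written here
as c*f0 + d*f1), together with the reversed inequality outside [x0,x2]. -/
theorem convexity_chord_characterization
    (a b : ℝ) (hab : a < b) (f0 f1 f : ℝ → ℝ)
    (hHaar : IsHaarPair a b f0 f1) :
    (ConvexWrt a b f0 f1 f ↔
      ∀ x0 x2 : ℝ, x0 ∈ Set.Icc a b → x2 ∈ Set.Icc a b → x0 < x2 →
        ∀ c d : ℝ,
          c * f0 x0 + d * f1 x0 = f x0 →
          c * f0 x2 + d * f1 x2 = f x2 →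
          ∀ x, x0 < x → x < x2 → f x ≤ c * f0 x + d * f1 x) ∧
    (ConvexWrt a b f0 f1 f →
      ∀ x0 x2 : ℝ, x0 ∈ Set.Icc a b → x2 ∈ Set.Icc a b → x0 < x2 →
        ∀ c d : ℝ,
          c * f0 x0 + d * f1 x0 = f x0 →
          c * f0 x2 + d * f1 x2 = f x2 →
          ∀ y ∈ Set.Icc a b, y ∉ Set.Icc x0 x2 → c * f0 y + d * f1 y ≤ f y) := by
  refine ⟨⟨?_, ?_⟩, ?_⟩
  · intro hf x0 x2 h0 h2 h02 c d e0 e2 x h0x hx2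
    have hx : x ∈ Set.Icc a b := ⟨h0.1.trans h0x.le, hx2.le.trans h2.2⟩
    have hdet := hf x0 h0 x hx x2 h2 h0x hx2
    rw [det_eq_sub_span f0 f1 f c d, e0, e2, sub_self, sub_self, zero_mul, zero_mul, zero_sub,
      add_zero, neg_nonneg] at hdet
    exact sub_nonpos.mp (nonpos_of_mul_nonpos_left hdet (hHaar.wronskian_pos h0 h2 h02))
  · intro H x0 h0 x1 h1 x2 h2 h01 h12
    have h02 := h01.trans h12
    obtain ⟨c, d, e0, e2⟩ := hHaar.exists_interpolant h0 h2 h02 (f x0) (f x2)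
    rw [det_eq_sub_span f0 f1 f c d, e0, e2, sub_self, sub_self, zero_mul, zero_mul, zero_sub,
      add_zero, neg_nonneg]
    exact mul_nonpos_of_nonpos_of_nonneg
      (sub_nonpos.mpr (H x0 x2 h0 h2 h02 c d e0 e2 x1 h01 h12))
      (hHaar.wronskian_pos h0 h2 h02).le
  · intro hf x0 x2 h0 h2 h02 c d e0 e2 y hy hy'
    have hW := hHaar.wronskian_pos h0 h2 h02
    rcases lt_or_ge y x0 with hy0 | hy0
    · have hdet := hf y hy x0 h0 x2 h2 hy0 h02
      rw [det_eq_sub_span f0 f1 f c d, e0, e2, sub_self, sub_self, zero_mul, zero_mul, sub_zero,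
        add_zero] at hdet
      exact sub_nonneg.mp (nonneg_of_mul_nonneg_left hdet hW)
    · have hy2 : x2 < y := lt_of_not_ge fun h => hy' ⟨hy0, h⟩
      have hdet := hf x0 h0 x2 h2 y hy h02 hy2
      rw [det_eq_sub_span f0 f1 f c d, e0, e2, sub_self, sub_self, zero_mul, zero_mul, sub_zero,
        zero_add] at hdet
      exact sub_nonneg.mp (nonneg_of_mul_nonneg_left hdet hW)
end

section
/- Let n ≥ 1, let U_n ⊂ C^n([a,b]) be an (n+1)-dimensional subspace with a non-negative Bernstein basis, let (f_0, f_1) be a Haar pair with f_0, f_1 ∈ U_n, and assume there exists a Bernstein operator B_n : C[a,b] → U_n fixing f_0 and f_1 (with nodes in [a,b] and positive coefficients, no monotonicity of the nodes assumed). Then for every continuous (f_0,f_1)-convex function f on [a,b], one has B_n f(x) ≥ f(x) for all x ∈ [a,b]. -/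
open Finset

/-- Convexity with respect to a Haar pair, expressed through the chord slopes of `f / f0` as a
function of `f1 / f0`. -/
lemma ConvexWrt.slope_le_slope {a b : ℝ} {f0 f1 f : ℝ → ℝ} (hHaar : IsHaarPair a b f0 f1)
    (hconv : ConvexWrt a b f0 f1 f) {y x z : ℝ} (hy : y ∈ Set.Icc a b) (hx : x ∈ Set.Icc a b)
    (hz : z ∈ Set.Icc a b) (hyx : y < x) (hxz : x < z) :
    (f x / f0 x - f y / f0 y) / (f1 x / f0 x - f1 y / f0 y) ≤
      (f z / f0 z - f x / f0 x) / (f1 z / f0 z - f1 x / f0 x) := by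
  obtain ⟨-, -, hpos, hmono⟩ := hHaar
  have h₁ : f1 y / f0 y < f1 x / f0 x := hmono hy hx hyx
  have h₂ : f1 x / f0 x < f1 z / f0 z := hmono hx hz hxz
  have py := hpos y hy
  have px := hpos x hx
  have pz := hpos z hz
  rw [div_le_div_iff₀ (sub_pos.2 h₁) (sub_pos.2 h₂), ← sub_nonneg]
  have hdet := hconv y hy x hx z hz hyx hxz
  rw [Matrix.det_fin_three] at hdet
  simp only [Matrix.of_apply, Matrix.cons_val] at hdet
  refine (div_nonneg hdet (mul_pos (mul_pos py px) pz).le).trans_eq ?_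
  field_simp
  ring

/-- A function convex with respect to a Haar pair has a support function in the span of the pair
at every interior point. -/
lemma ConvexWrt.exists_support {a b : ℝ} {f0 f1 f : ℝ → ℝ} (hHaar : IsHaarPair a b f0 f1)
    (hconv : ConvexWrt a b f0 f1 f) {x : ℝ} (hx : x ∈ Set.Ioo a b) :
    ∃ c d : ℝ, c * f0 x + d * f1 x = f x ∧ ∀ y ∈ Set.Icc a b, c * f0 y + d * f1 y ≤ f y := by
  have hxI := Set.Ioo_subset_Icc_self hx
  obtain ⟨-, -, hpos, hmono⟩ := id hHaar
  obtain ⟨d, hd₁, hd₂⟩ := exists_between_of_forall_le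
    (s := (fun y => (f x / f0 x - f y / f0 y) / (f1 x / f0 x - f1 y / f0 y)) '' Set.Ico a x)
    (t := (fun z => (f z / f0 z - f x / f0 x) / (f1 z / f0 z - f1 x / f0 x)) '' Set.Ioc x b)
    ((Set.nonempty_Ico.2 hx.1).image _) ((Set.nonempty_Ioc.2 hx.2).image _) (by
      rintro _ ⟨y, hy, rfl⟩ _ ⟨z, hz, rfl⟩
      exact hconv.slope_le_slope hHaar ⟨hy.1, hy.2.le.trans hxI.2⟩ hxI
        ⟨hxI.1.trans hz.1.le, hz.2⟩ hy.2 hz.1)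
  have px := hpos x hxI
  refine ⟨f x / f0 x - d * (f1 x / f0 x), d, by field_simp; ring, fun y hy => ?_⟩
  have py := hpos y hy
  suffices h : f x / f0 x + d * (f1 y / f0 y - f1 x / f0 x) ≤ f y / f0 y by
    rw [le_div_iff₀ py] at h
    refine Eq.trans_le ?_ h
    field_simp
    ring
  rcases lt_trichotomy y x with hyx | rfl | hxy
  · have h : f1 y / f0 y < f1 x / f0 x := hmono hy hxI hyx
    have hd := hd₁ ⟨y, ⟨hy.1, hyx⟩, rfl⟩
    simp only [div_le_iff₀ (sub_pos.2 h)] at hd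
    linarith
  · simp
  · have h : f1 x / f0 x < f1 y / f0 y := hmono hxI hy hxy
    have hd := hd₂ ⟨y, ⟨hxy, hy.2⟩, rfl⟩
    simp only [le_div_iff₀ (sub_pos.2 h)] at hd
    linarith

/-- a Bernstein operator fixing a Haar pair majorizes every
continuous (f0,f1)-convex function. -/
theorem bernstein_operator_majorizes_convex
    (n : ℕ) (hn : 1 ≤ n) (a b : ℝ) (hab : a < b)
    (U : Submodule ℝ (ℝ → ℝ)) (hdim : Module.finrank ℝ U = n + 1)
    (p : ℕ → ℝ → ℝ) (hp : IsNonnegBernsteinBasisOf n a b U p)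
    (f0 f1 : ℝ → ℝ) (hf0U : f0 ∈ U) (hf1U : f1 ∈ U)
    (hHaar : IsHaarPair a b f0 f1)
    (t : ℕ → ℝ) (α : ℕ → ℝ)
    (ht : ∀ k ≤ n, t k ∈ Set.Icc a b)
    (hα : ∀ k ≤ n, 0 < α k)
    (hfix0 : FixesOn a b (bernOp n p t α) f0)
    (hfix1 : FixesOn a b (bernOp n p t α) f1)
    (f : ℝ → ℝ) (hf : ContinuousOn f (Set.Icc a b))
    (hconv : ConvexWrt a b f0 f1 f) :
    ∀ x ∈ Set.Icc a b, f x ≤ bernOp n p t α f x := by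
  obtain ⟨⟨-, hsmooth, -⟩, hnonneg⟩ := hp
  have interior : ∀ x ∈ Set.Ioo a b, f x ≤ bernOp n p t α f x := by
    intro x hx
    have hxI := Set.Ioo_subset_Icc_self hx
    obtain ⟨c, d, hcd, hle⟩ := hconv.exists_support hHaar hx
    rw [← hcd, ← hfix0 x hxI, ← hfix1 x hxI]
    simp only [bernOp, Finset.mul_sum, ← Finset.sum_add_distrib]
    refine Finset.sum_le_sum fun k hk => ?_
    have hk : k ≤ n := Finset.mem_range_succ_iff.1 hk
    calc c * (f0 (t k) * α k * p k x) + d * (f1 (t k) * α k * p k x)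
        = (c * f0 (t k) + d * f1 (t k)) * (α k * p k x) := by ring
      _ ≤ f (t k) * (α k * p k x) :=
          mul_le_mul_of_nonneg_right (hle _ (ht k hk)) (mul_nonneg (hα k hk).le (hnonneg k hk x hxI))
      _ = f (t k) * α k * p k x := by ring
  have hcont : Continuous (bernOp n p t α f) :=
    continuous_finsetSum _ fun k hk =>
      continuous_const.mul (hsmooth k (Finset.mem_range_succ_iff.1 hk)).continuous
  have hclosure := closure_Ioo hab.ne
  intro x hx
  exact le_on_closure interior (hclosure ▸ hf) hcont.continuousOn (hclosure ▸ hx)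
end
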